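/- arXiv:2601.19230 — 3 statements merged into one kernel-verified Lean document; each statement's English description precedes it below -/
import Mathlib

section
/- For every integer t ≥ 2 and every integer k ≥ 1, the Dyck-grid D_t^{(0,1)} is not a minor of the Dyck-grid D_k^{(t−1,0)}. -/
open SimpleGraph

/-- `H` is a minor of `G`: there is a minor model of `H` in `G`, i.e. a family of pairwise
disjoint connected branch sets, one for each vertex of `H`, such that every edge of `H` is
realised by an edge of `G` between the corresponding branch sets. -/
def IsMinorOf {α β : Type*} (H : SimpleGraph α) (G : SimpleGraph β) : Prop :=
  ∃ X : α → Set β,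
    (∀ u v : α, u ≠ v → Disjoint (X u) (X v)) ∧
    (∀ v : α, (G.induce (X v)).Connected) ∧
    (∀ u v : α, H.Adj u v → ∃ a ∈ X u, ∃ b ∈ X v, G.Adj a b)

/-- The mixed surface grid of order `k` built from the `(k, 4*n*k)`-cylindrical grid
(where `n = h + c + 1`), with a handle added at every position in `Ih` and a crosscap added
at every position in `Ic`.  The vertex `v_j^i` (for `i ∈ [k]`, `j ∈ ℤ/(4nk)`) is encoded as
`(⟨i - 1⟩, j)`, so the top row `v^1` corresponds to first coordinate `0`. -/
def mixedGrid (k n : ℕ) (Ih Ic : Finset ℕ) :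
    SimpleGraph (Fin k × ZMod (4 * n * k)) :=
  SimpleGraph.fromRel (fun p q =>
    (p.1 = q.1 ∧ q.2 = p.2 + 1) ∨
    (p.2 = q.2 ∧ (q.1 : ℕ) = (p.1 : ℕ) + 1) ∨
    ((p.1 : ℕ) = 0 ∧ (q.1 : ℕ) = 0 ∧ ∃ i ∈ Ih, ∃ j ∈ Finset.Icc 1 k,
      ((p.2 = ((4 * k * (i - 1) + j : ℕ) : ZMod (4 * n * k)) ∧
        q.2 = ((4 * k * (i - 1) + 3 * k - j + 1 : ℕ) : ZMod (4 * n * k))) ∨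
       (p.2 = ((4 * k * (i - 1) + k + j : ℕ) : ZMod (4 * n * k)) ∧
        q.2 = ((4 * k * (i - 1) + 4 * k - j + 1 : ℕ) : ZMod (4 * n * k))))) ∨
    ((p.1 : ℕ) = 0 ∧ (q.1 : ℕ) = 0 ∧ ∃ i ∈ Ic, ∃ j ∈ Finset.Icc 1 (2 * k),
      p.2 = ((4 * k * (i - 1) + j : ℕ) : ZMod (4 * n * k)) ∧
      q.2 = ((4 * k * (i - 1) + 2 * k + j : ℕ) : ZMod (4 * n * k))))

/-- The Dyck grid `D_k^{(h,c)}`. -/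
def dyckGrid (k h c : ℕ) : SimpleGraph (Fin k × ZMod (4 * (h + c + 1) * k)) :=
  mixedGrid k (h + c + 1) (Finset.Icc 2 (h + 1)) (Finset.Icc (h + 2) (h + c + 1))

/-! ### Chains in a graph carrying a mod 2 drawing -/

section Chains

set_option linter.unusedSectionVars false

variable {V W : Type*} [AddCommGroup W] [Module (ZMod 2) W]

/-- Chains inside `S`: built from the drawn edges `Ed a b y T`. -/
inductive Ch (Ed : V → V → W → (V → ZMod 2) → Prop) (S : Set V) :
    V → V → W → (V → ZMod 2) → Prop
  | nil (a : V) (ha : a ∈ S) : Ch Ed S a a 0 0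
  | edge (a b : V) (y : W) (T : V → ZMod 2) (ha : a ∈ S) (hb : b ∈ S) (h : Ed a b y T) :
      Ch Ed S a b y T
  | symm (a b : V) (y : W) (T : V → ZMod 2) (h : Ch Ed S a b y T) : Ch Ed S b a y T
  | trans (a b c : V) (y y2 : W) (T T2 : V → ZMod 2) (h : Ch Ed S a b y T)
      (h2 : Ch Ed S b c y2 T2) : Ch Ed S a c (y + y2) (T + T2)

/-- The mod 2 drawing condition. -/
structure Good (ω : W →ₗ[ZMod 2] W →ₗ[ZMod 2] ZMod 2) (L : V → V → ZMod 2)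
    (Ed : V → V → W → (V → ZMod 2) → Prop) : Prop where
  tour : ∀ a c, a ≠ c → L a c + L c a = 1
  form : ∀ a b y T c d y' T', Ed a b y T → Ed c d y' T' → a ≠ c → a ≠ d → b ≠ c → b ≠ d →
    ω y y' = L a c + L a d + L b c + L b d + T c + T d + T' a + T' b

theorem Ch.mem {Ed : V → V → W → (V → ZMod 2) → Prop} {S : Set V} {a b : V} {y : W}
    {T : V → ZMod 2} (h : Ch Ed S a b y T) : a ∈ S ∧ b ∈ S := by
  induction h with
  | nil a ha => exact ⟨ha, ha⟩
  | edge a b y T ha hb h => exact ⟨ha, hb⟩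
  | symm a b y T h ih => exact ⟨ih.2, ih.1⟩
  | trans a b c y y' T T' h h' ih ih' => exact ⟨ih.1, ih'.2⟩

theorem Ch.mono {Ed : V → V → W → (V → ZMod 2) → Prop} {S S' : Set V} {a b : V} {y : W}
    {T : V → ZMod 2} (h : Ch Ed S a b y T) (hS : S ⊆ S') : Ch Ed S' a b y T := by
  induction h with
  | nil a ha => exact .nil a (hS ha)
  | edge a b y T ha hb h => exact .edge a b y T (hS ha) (hS hb) h
  | symm a b y T h ih => exact .symm _ _ _ _ ih
  | trans a b c y y' T T' h h' ih ih' => exact .trans _ _ _ _ _ _ _ ih ih'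

theorem two_zero2 : (2 : ZMod 2) = 0 := rfl

theorem dbl2 (x : ZMod 2) : x + x = 0 := CharTwo.add_self_eq_zero x

theorem Ch.inter {ω : W →ₗ[ZMod 2] W →ₗ[ZMod 2] ZMod 2} {L : V → V → ZMod 2}
    {Ed : V → V → W → (V → ZMod 2) → Prop} (hG : Good ω L Ed) {S S' : Set V}
    (hS : Disjoint S S') {a b c d : V} {y y' : W} {T T' : V → ZMod 2}
    (h : Ch Ed S a b y T) (h' : Ch Ed S' c d y' T') :
    ω y y' = L a c + L a d + L b c + L b d + T c + T d + T' a + T' b := by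
  have ne : ∀ {x z}, x ∈ S → z ∈ S' → x ≠ z := fun hx hz => Set.disjoint_left.1 hS |> fun f e =>
    f hx (e ▸ hz)
  induction h with
  | nil a ha =>
    simp only [map_zero, LinearMap.zero_apply, Pi.zero_apply]
    linear_combination -(dbl2 (L a c)) - dbl2 (L a d) - dbl2 (T' a)
  | symm a b y T h ih => rw [ih]; ring
  | trans a b e y y1 T T1 h h1 ih ih1 =>
    simp only [map_add, LinearMap.add_apply, Pi.add_apply]
    rw [ih, ih1]
    linear_combination dbl2 (L b c) + dbl2 (L b d) + dbl2 (T' b)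
  | edge a b y T ha hb hE =>
    induction h' with
    | nil c hc =>
      simp only [map_zero, Pi.zero_apply]
      linear_combination -(dbl2 (L a c)) - dbl2 (L b c) - dbl2 (T c)
    | symm c d y' T' h ih => rw [ih]; ring
    | trans c e d y1 y2 T1 T2 h1 h2 ih1 ih2 =>
      simp only [map_add, Pi.add_apply]
      rw [ih1, ih2]
      linear_combination dbl2 (L a e) + dbl2 (L b e) + dbl2 (T e)
    | edge c d y' T' hc hd hE' =>
      exact hG.form _ _ _ _ _ _ _ _ hE hE' (ne ha hc) (ne ha hd) (ne hb hc) (ne hb hd)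

/-- The `K_{3,3}` identity. -/
theorem k33 {ω : W →ₗ[ZMod 2] W →ₗ[ZMod 2] ZMod 2} (hω : ∀ x, ω x x = 0)
    (hsym : ∀ x y, ω x y = ω y x) {L : V → V → ZMod 2}
    {Ed : V → V → W → (V → ZMod 2) → Prop} (hG : Good ω L Ed)
    {v1 v2 v3 v4 v5 v6 : V} {H1 H2 H3 H4 H5 H6 C1 C2 C3 : Set V}
    {h1 h2 h3 h4 h5 h6 c1 c2 c3 : W} {t1 t2 t3 t4 t5 t6 s1 s2 s3 : V → ZMod 2}
    (k1 : Ch Ed H1 v1 v2 h1 t1) (k2 : Ch Ed H2 v2 v3 h2 t2) (k3 : Ch Ed H3 v3 v4 h3 t3)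
    (k4 : Ch Ed H4 v4 v5 h4 t4) (k5 : Ch Ed H5 v5 v6 h5 t5) (k6 : Ch Ed H6 v6 v1 h6 t6)
    (l1 : Ch Ed C1 v1 v4 c1 s1) (l2 : Ch Ed C2 v2 v5 c2 s2) (l3 : Ch Ed C3 v3 v6 c3 s3)
    (d1 : Disjoint C1 C2) (d2 : Disjoint C1 C3) (d3 : Disjoint C2 C3)
    (d4 : Disjoint C1 H2) (d5 : Disjoint C1 H5) (d6 : Disjoint C2 H3) (d7 : Disjoint C2 H6)
    (d8 : Disjoint C3 H1) (d9 : Disjoint C3 H4)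
    (e1 : Disjoint H1 H3) (e2 : Disjoint H1 H4) (e3 : Disjoint H1 H5)
    (e4 : Disjoint H2 H4) (e5 : Disjoint H2 H5) (e6 : Disjoint H2 H6)
    (e7 : Disjoint H3 H5) (e8 : Disjoint H3 H6) (e9 : Disjoint H4 H6) :
    ω (c1 + h1 + h2 + h3) (c2 + h2 + h3 + h4) + ω (c2 + h2 + h3 + h4) (c3 + h3 + h4 + h5)
      + ω (c1 + h1 + h2 + h3) (c3 + h3 + h4 + h5)
      + ω (h1 + h2 + h3 + h4 + h5 + h6) (c2 + h2 + h3 + h4) = 1 := by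
  have ne : ∀ {A B : Set V} {x z}, Disjoint A B → x ∈ A → z ∈ B → x ≠ z :=
    fun hS hx hz => Set.disjoint_left.1 hS |> fun f e => f hx (e ▸ hz)
  have q12 := hG.tour v1 v2 (ne d1 l1.mem.1 l2.mem.1)
  have q13 := hG.tour v1 v3 (ne d2 l1.mem.1 l3.mem.1)
  have q14 := hG.tour v1 v4 (ne e1 k1.mem.1 k3.mem.2)
  have q15 := hG.tour v1 v5 (ne d1 l1.mem.1 l2.mem.2)
  have q16 := hG.tour v1 v6 (ne d2 l1.mem.1 l3.mem.2)
  have q23 := hG.tour v2 v3 (ne d3 l2.mem.1 l3.mem.1)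
  have q24 := hG.tour v2 v4 (ne d1 l1.mem.2 l2.mem.1).symm
  have q25 := hG.tour v2 v5 (ne e2 k1.mem.2 k4.mem.2)
  have q26 := hG.tour v2 v6 (ne d3 l2.mem.1 l3.mem.2)
  have q34 := hG.tour v3 v4 (ne d2 l1.mem.2 l3.mem.1).symm
  have q35 := hG.tour v3 v5 (ne d3 l2.mem.2 l3.mem.1).symm
  have q36 := hG.tour v3 v6 (ne e5 k2.mem.2 k5.mem.2)
  have q45 := hG.tour v4 v5 (ne d1 l1.mem.2 l2.mem.2)
  have q46 := hG.tour v4 v6 (ne d2 l1.mem.2 l3.mem.2)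
  have q56 := hG.tour v5 v6 (ne d3 l2.mem.2 l3.mem.2)
  have E1 := Ch.inter hG d1 l1 l2
  have E2 := Ch.inter hG d2 l1 l3
  have E3 := Ch.inter hG d3 l2 l3
  have E4 := Ch.inter hG d4 l1 k2
  have E5 := Ch.inter hG d5 l1 k5
  have E6 := Ch.inter hG d6 l2 k3
  have E7 := Ch.inter hG d7 l2 k6
  have E8 := Ch.inter hG d8 l3 k1
  have E9 := Ch.inter hG d9 l3 k4
  have F1 := Ch.inter hG e1 k1 k3
  have F2 := Ch.inter hG e2 k1 k4
  have F3 := Ch.inter hG e3 k1 k5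
  have F4 := Ch.inter hG e4 k2 k4
  have F5 := Ch.inter hG e5 k2 k5
  have F6 := Ch.inter hG e6 k2 k6
  have F7 := Ch.inter hG e7 k3 k5
  have F8 := Ch.inter hG e8 k3 k6
  have F9 := Ch.inter hG e9 k4 k6
  clear d1 d2 d3 d4 d5 d6 d7 d8 d9 e1 e2 e3 e4 e5 e6 e7 e8 e9 k1 k2 k3 k4 k5 k6 l1 l2 l3
  have key : ω (c1 + h1 + h2 + h3) (c2 + h2 + h3 + h4)
      + ω (c2 + h2 + h3 + h4) (c3 + h3 + h4 + h5)
      + ω (c1 + h1 + h2 + h3) (c3 + h3 + h4 + h5)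
      + ω (h1 + h2 + h3 + h4 + h5 + h6) (c2 + h2 + h3 + h4) =
      (ω c1 c2 + ω c1 c3 + ω c2 c3) + (ω c1 h2 + ω c1 h5 + ω c2 h3 + ω c2 h6 + ω c3 h1 + ω c3 h4)
      + (ω h1 h3 + ω h1 h4 + ω h1 h5 + ω h2 h4 + ω h2 h5 + ω h2 h6 + ω h3 h5 + ω h3 h6
        + ω h4 h6) := by
    simp only [map_add, LinearMap.add_apply, hω]
    rw [hsym h1 c2, hsym h2 c2, hsym h3 c2, hsym h4 c2, hsym h5 c2, hsym h6 c2, hsym h1 c3,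
      hsym h2 c3, hsym h3 c3, hsym h4 c3, hsym h3 h2, hsym h4 h2, hsym h4 h3, hsym h5 h2,
      hsym h5 h3, hsym h5 h4, hsym h6 h2, hsym h6 h3, hsym h6 h4]
    ring_nf
    reduce_mod_char
  rw [key, E1, E2, E3, E4, E5, E6, E7, E8, E9, F1, F2, F3, F4, F5, F6, F7, F8, F9]
  have sw : ∀ {x y : ZMod 2}, x + y = 1 → y = 1 + x := by decide
  simp only [sw q12, sw q13, sw q14, sw q15, sw q16, sw q23, sw q24, sw q25, sw q26, sw q34, sw q35,
    sw q36, sw q45, sw q46, sw q56]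
  ring_nf
  reduce_mod_char

end Chains


/-! ### Linear algebra -/

section LinAlg

variable {W : Type*} [AddCommGroup W] [Module (ZMod 2) W] [FiniteDimensional (ZMod 2) W]

theorem isotropic_bound (ω : W →ₗ[ZMod 2] W →ₗ[ZMod 2] ZMod 2)
    (hsym : ∀ x y, ω x y = ω y x) (hnd : ∀ a, (∀ w, ω a w = 0) → a = 0)
    {t : ℕ} (a : Fin t → W) (ha : LinearIndependent (ZMod 2) a) (h0 : ∀ i j, ω (a i) (a j) = 0) :
    2 * t ≤ Module.finrank (ZMod 2) W := by
  have hN : LinearMap.BilinForm.Nondegenerate ω := by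
    refine ⟨fun a h => hnd a h, fun a h => hnd a fun w => ?_⟩
    rw [hsym]; exact h w
  have h1 := LinearMap.BilinForm.finrank_orthogonal hN (Submodule.span (ZMod 2) (Set.range a))
  have h2 : Submodule.span (ZMod 2) (Set.range a) ≤
      LinearMap.BilinForm.orthogonal ω (Submodule.span (ZMod 2) (Set.range a)) := by
    rw [Submodule.span_le]
    rintro _ ⟨i, rfl⟩
    intro x hx
    show ω x (a i) = 0
    refine Submodule.span_induction (p := fun x _ => ω x (a i) = 0) ?_ ?_ ?_ ?_ hx
    · rintro _ ⟨j, rfl⟩; exact h0 j i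
    · simp
    · intro x y _ _ hx hy; simp [hx, hy]
    · intro c x _ hx; simp [hx]
  have h3 := Submodule.finrank_mono h2
  have h4 : Module.finrank (ZMod 2) (Submodule.span (ZMod 2) (Set.range a)) = t := by
    rw [finrank_span_eq_card ha]; simp
  have h5 := Submodule.finrank_le (Submodule.span (ZMod 2) (Set.range a))
  omega

theorem gram_lemma (ω : W →ₗ[ZMod 2] W →ₗ[ZMod 2] ZMod 2) (hω : ∀ x, ω x x = 0)
    {n : ℕ} (q : Fin n → W) (s : Fin n → ZMod 2)
    (hN : ∀ j k, j ≠ k → ω (q j) (q k) = 1 + s j + s k)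
    (hd : Module.finrank (ZMod 2) W + 2 ≤ n) :
    (∀ a, (∀ j, ω a (q j) = 0) → ∀ w, ω a w = 0) ∧ ∑ j, s j • q j = 0 ∧ ∑ j, s j = 1 ∧
      ∃ k, s k = 0 := by
  classical
  set f := Fintype.linearCombination (ZMod 2) q with hf
  have hfa : ∀ l, f l = ∑ j, l j • q j := fun l => Fintype.linearCombination_apply _ _ _
  have hNall : ∀ j k, ω (q j) (q k) = (1 + s j + s k) + (if j = k then 1 else 0) := by
    intro j k
    by_cases h : j = k
    · subst h; rw [hω, if_pos rfl]; generalize s j = x; revert x; decide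
    · rw [hN j k h, if_neg h, add_zero]
  have hker : ∀ l, f l = 0 → ∀ k, l k = (∑ j, l j * (1 + s j)) + s k * ∑ j, l j := by
    intro l hl k
    have h1 : ω (f l) (q k) = 0 := by rw [hl]; simp
    rw [hfa, map_sum, LinearMap.sum_apply] at h1
    simp only [map_smul, LinearMap.smul_apply, smul_eq_mul, hNall, mul_add, mul_ite, mul_one,
      mul_zero, Finset.sum_add_distrib, Finset.sum_ite_eq', Finset.mem_univ, if_true] at h1
    simp only [mul_add, mul_one, Finset.sum_add_distrib]
    rw [Finset.mul_sum]
    simp only [mul_comm (s k)]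
    have sw : ∀ x y : ZMod 2, x + y = 0 → y = x := by decide
    exact sw _ _ h1
  have hspan : LinearMap.ker f ≤ Submodule.span (ZMod 2) {(1 : Fin n → ZMod 2), s} := by
    intro l hl
    rw [LinearMap.mem_ker] at hl
    rw [Submodule.mem_span_pair]
    refine ⟨∑ j, l j * (1 + s j), ∑ j, l j, ?_⟩
    ext k
    simp only [Pi.add_apply, Pi.smul_apply, Pi.one_apply, smul_eq_mul, mul_one]
    rw [hker l hl k]; ring
  have hrn := LinearMap.finrank_range_add_finrank_ker f
  rw [Module.finrank_fin_fun] at hrn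
  have hrl := Submodule.finrank_le (LinearMap.range f)
  have hkl := Submodule.finrank_mono hspan
  have h2 : Module.finrank (ZMod 2) (Submodule.span (ZMod 2) {(1 : Fin n → ZMod 2), s}) ≤ 2 := by
    have := finrank_span_finset_le_card (R := ZMod 2) ({(1 : Fin n → ZMod 2), s} : Finset _)
    have h3 := Finset.card_le_two (a := (1 : Fin n → ZMod 2)) (b := s)
    simp only [Finset.coe_insert, Finset.coe_singleton] at this
    unfold Set.finrank at this
    omega
  have hkeq : LinearMap.ker f = Submodule.span (ZMod 2) {(1 : Fin n → ZMod 2), s} :=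
    Submodule.eq_of_le_of_finrank_le hspan (by omega)
  have hrange : LinearMap.range f = ⊤ := Submodule.eq_top_of_finrank_eq (by omega)
  have hs : f s = 0 := by
    rw [← LinearMap.mem_ker, hkeq]; exact Submodule.subset_span (by simp)
  have hone : ∀ c : ZMod 2, (∀ k, s k = c) → False := by
    intro c hc
    have : Submodule.span (ZMod 2) {(1 : Fin n → ZMod 2), s} ≤
        Submodule.span (ZMod 2) {(1 : Fin n → ZMod 2)} := by
      rw [Submodule.span_le]
      rintro x (rfl | rfl)
      · exact Submodule.subset_span (by simp)
      · rw [SetLike.mem_coe, Submodule.mem_span_singleton]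
        exact ⟨c, by ext k; simp [hc k]⟩
    have h3 := Submodule.finrank_mono this
    have h4 := finrank_span_finset_le_card (R := ZMod 2) ({(1 : Fin n → ZMod 2)} : Finset _)
    simp only [Finset.coe_singleton, Finset.card_singleton] at h4
    unfold Set.finrank at h4
    omega
  have bit : ∀ x : ZMod 2, x = 0 ∨ x = 1 := by decide
  refine ⟨?_, by rw [← hfa, hs], ?_, ?_⟩
  · intro a ha w
    have : w ∈ LinearMap.range f := by rw [hrange]; trivial
    obtain ⟨l, rfl⟩ := this
    rw [hfa, map_sum]
    simp [ha]
  · obtain ⟨k, hk⟩ : ∃ k, s k = 1 := by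
      by_contra hcon
      push Not at hcon
      exact hone 0 fun k => (bit (s k)).resolve_right (hcon k)
    have := hker s hs k
    have h0 : ∀ x : ZMod 2, x * (1 + x) = 0 := by decide
    simp only [h0, Finset.sum_const_zero, zero_add, hk, one_mul] at this
    exact this.symm
  · by_contra hcon
    push Not at hcon
    exact hone 1 fun k => (bit (s k)).resolve_left (hcon k)

end LinAlg

/-! ### The combinatorial core -/

section Core

variable {W : Type*} [AddCommGroup W] [Module (ZMod 2) W]

theorem dblW (x : W) : x + x = 0 := by
  have h : ((1 : ZMod 2) + 1) • x = 0 := by rw [dbl2, zero_smul]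
  rwa [add_smul, one_smul] at h

/-- Abstract chains in a pulled back projective grid, `t` rows, `N` columns, `n` chords. -/
structure KS (ω : W →ₗ[ZMod 2] W →ₗ[ZMod 2] ZMod 2) (t n N : ℕ)
    (K : (ℕ → ℕ → Prop) → ℕ → ℕ → ℕ → ℕ → W → Prop) (R Sp : ℕ → ℕ → W) (wr E : ℕ → W) :
    Prop where
  mono : ∀ {S S' : ℕ → ℕ → Prop} {a b c d y}, K S a b c d y → (∀ i x, S i x → S' i x) →
    K S' a b c d y
  symm : ∀ {S a b c d y}, K S a b c d y → K S c d a b y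
  trans : ∀ {S a b c d e f y y'}, K S a b c d y → K S c d e f y' → K S a b e f (y + y')
  nil : ∀ i c, i < t → c < N → K (fun x y => x = i ∧ y = c) i c i c 0
  ring : ∀ i c, i < t → c + 1 < N → K (fun x y => x = i ∧ (y = c ∨ y = c + 1)) i c i (c + 1) (R i c)
  wrap : ∀ i, i < t → K (fun x y => x = i ∧ (y = 0 ∨ y = N - 1)) i (N - 1) i 0 (wr i)
  spoke : ∀ i c, i + 1 < t → c < N → K (fun x y => (x = i ∨ x = i + 1) ∧ y = c) i c (i + 1) c (Sp i c)
  chord : ∀ j, j < n → K (fun x y => x = 0 ∧ (y = j ∨ y = j + n)) 0 j 0 (j + n) (E j)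
  inter0 : ∀ {S S' : ℕ → ℕ → Prop} {a b c d y y'}, K S a b a b y → K S' c d c d y' →
    (∀ i x, S i x → S' i x → False) → ω y y' = 0
  k33 : ∀ {a1 a2 a3 a4 a5 a6 b1 b2 b3 b4 b5 b6} {H1 H2 H3 H4 H5 H6 C1 C2 C3 : ℕ → ℕ → Prop}
    {h1 h2 h3 h4 h5 h6 c1 c2 c3 : W},
    K H1 a1 b1 a2 b2 h1 → K H2 a2 b2 a3 b3 h2 → K H3 a3 b3 a4 b4 h3 →
    K H4 a4 b4 a5 b5 h4 → K H5 a5 b5 a6 b6 h5 → K H6 a6 b6 a1 b1 h6 →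
    K C1 a1 b1 a4 b4 c1 → K C2 a2 b2 a5 b5 c2 → K C3 a3 b3 a6 b6 c3 →
    (∀ i x, C1 i x → C2 i x → False) → (∀ i x, C1 i x → C3 i x → False) →
    (∀ i x, C2 i x → C3 i x → False) → (∀ i x, C1 i x → H2 i x → False) →
    (∀ i x, C1 i x → H5 i x → False) → (∀ i x, C2 i x → H3 i x → False) →
    (∀ i x, C2 i x → H6 i x → False) → (∀ i x, C3 i x → H1 i x → False) →
    (∀ i x, C3 i x → H4 i x → False) → (∀ i x, H1 i x → H3 i x → False) →
    (∀ i x, H1 i x → H4 i x → False) → (∀ i x, H1 i x → H5 i x → False) →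
    (∀ i x, H2 i x → H4 i x → False) → (∀ i x, H2 i x → H5 i x → False) →
    (∀ i x, H2 i x → H6 i x → False) → (∀ i x, H3 i x → H5 i x → False) →
    (∀ i x, H3 i x → H6 i x → False) → (∀ i x, H4 i x → H6 i x → False) →
    ω (c1 + h1 + h2 + h3) (c2 + h2 + h3 + h4) + ω (c2 + h2 + h3 + h4) (c3 + h3 + h4 + h5)
      + ω (c1 + h1 + h2 + h3) (c3 + h3 + h4 + h5)
      + ω (h1 + h2 + h3 + h4 + h5 + h6) (c2 + h2 + h3 + h4) = 1

namespace KS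

variable {ω : W →ₗ[ZMod 2] W →ₗ[ZMod 2] ZMod 2} {t n N : ℕ}
    {K : (ℕ → ℕ → Prop) → ℕ → ℕ → ℕ → ℕ → W → Prop} {R Sp : ℕ → ℕ → W} {wr E : ℕ → W}

/-- partial sums along a ring -/
def pre (R : ℕ → ℕ → W) (i c : ℕ) : W := ∑ x ∈ Finset.range c, R i x

theorem pre_zero (R : ℕ → ℕ → W) (i : ℕ) : pre R i 0 = 0 := by simp [pre]

theorem pre_succ (R : ℕ → ℕ → W) (i c : ℕ) : pre R i (c + 1) = pre R i c + R i c := by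
  simp [pre, Finset.sum_range_succ]

/-- ring class -/
def rg (N : ℕ) (R : ℕ → ℕ → W) (wr : ℕ → W) (i : ℕ) : W := pre R i (N - 1) + wr i

theorem cast (_hK : KS ω t n N K R Sp wr E) {S : ℕ → ℕ → Prop} {a b c d : ℕ} {y y' : W}
    (h : K S a b c d y) (e : y = y') : K S a b c d y' := e ▸ h

theorem arc (hK : KS ω t n N K R Sp wr E) {i p q : ℕ} (hi : i < t) (hpq : p ≤ q) (hq : q < N) :
    K (fun x y => x = i ∧ p ≤ y ∧ y ≤ q) i p i q (pre R i p + pre R i q) := by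
  induction q, hpq using Nat.le_induction with
  | base =>
    rw [dblW]
    exact hK.mono (hK.nil i p hi hq) (by intros; omega)
  | succ q hpq ih =>
    rw [pre_succ, ← add_assoc]
    exact hK.trans (hK.mono (ih (by omega)) (by intros; omega))
      (hK.mono (hK.ring i q hi hq) (by intros; omega))

theorem coarc (hK : KS ω t n N K R Sp wr E) {i p q : ℕ} (hi : i < t) (hpq : p ≤ q) (hq : q < N) :
    K (fun x y => x = i ∧ (y ≤ p ∨ (q ≤ y ∧ y < N))) i q i p (rg N R wr i + pre R i p + pre R i q) := by
  have h1 := hK.arc hi (show q ≤ N - 1 by omega) (by omega)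
  have h2 := hK.wrap i hi
  have h3 := hK.arc hi (show 0 ≤ p by omega) (by omega)
  refine hK.cast (hK.trans (hK.mono h1 ?_) (hK.trans (hK.mono h2 ?_) (hK.mono h3 ?_))) ?_
  · intros; omega
  · intros; omega
  · intros; omega
  · rw [pre_zero, rg]; abel

theorem full (hK : KS ω t n N K R Sp wr E) {i : ℕ} (hi : i < t) (hN : 0 < N) :
    K (fun x y => x = i) i 0 i 0 (rg N R wr i) := by
  have h1 := hK.arc hi (show 0 ≤ N - 1 by omega) (by omega)
  have h2 := hK.wrap i hi
  refine hK.cast (hK.trans (hK.mono h1 ?_) (hK.mono h2 ?_)) ?_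
  · intros; omega
  · intros; omega
  · rw [pre_zero, rg]; abel

/-- extended chord -/
def Qv (n : ℕ) (Sp : ℕ → ℕ → W) (E : ℕ → W) : ℕ → ℕ → W
  | 0, j => E j
  | i + 1, j => Sp i j + (Qv n Sp E i j + Sp i (j + n))

theorem qch (hK : KS ω t n N K R Sp wr E) (hN : 2 * n ≤ N) {i j : ℕ} (hi : i < t) (hj : j < n) :
    K (fun x y => x ≤ i ∧ (y = j ∨ y = j + n)) i j i (j + n) (Qv n Sp E i j) := by
  induction i with
  | zero => exact hK.mono (hK.chord j hj) (by intros; omega)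
  | succ i ih =>
    refine hK.trans (hK.mono (hK.symm (hK.spoke i j hi (by omega))) ?_)
      (hK.trans (hK.mono (ih (by omega)) ?_) (hK.mono (hK.spoke i (j + n) hi (by omega)) ?_))
    all_goals intros; omega

/-- ladder potential -/
def G (R Sp : ℕ → ℕ → W) (i p : ℕ) : W := pre R i p + pre R (i + 1) p + Sp i p

theorem lad (hK : KS ω t n N K R Sp wr E) {i p q : ℕ} (hi : i + 1 < t) (hpq : p ≤ q) (hq : q < N) :
    K (fun x y => (x = i ∨ x = i + 1) ∧ p ≤ y ∧ y ≤ q) i p i p (G R Sp i p + G R Sp i q) := by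
  have h1 := hK.arc (show i < t by omega) hpq hq
  have h2 := hK.spoke i q hi hq
  have h3 := hK.symm (hK.arc hi hpq hq)
  have h4 := hK.symm (hK.spoke i p hi (by omega))
  refine hK.cast (hK.trans (hK.mono h1 ?_) (hK.trans (hK.mono h2 ?_)
    (hK.trans (hK.mono h3 ?_) (hK.mono h4 ?_)))) ?_
  · intros; omega
  · intros; omega
  · intros; omega
  · intros; omega
  · simp only [G]; abel

theorem colad (hK : KS ω t n N K R Sp wr E) {i p q : ℕ} (hi : i + 1 < t) (hpq : p ≤ q)
    (hq : q < N) :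
    K (fun x y => (x = i ∨ x = i + 1) ∧ (y ≤ p ∨ (q ≤ y ∧ y < N))) i q i q
      (G R Sp i p + G R Sp i q + rg N R wr i + rg N R wr (i + 1)) := by
  have h1 := hK.coarc (show i < t by omega) hpq hq
  have h2 := hK.spoke i p hi (by omega)
  have h3 := hK.symm (hK.coarc hi hpq hq)
  have h4 := hK.symm (hK.spoke i q hi hq)
  refine hK.cast (hK.trans (hK.mono h1 ?_) (hK.trans (hK.mono h2 ?_)
    (hK.trans (hK.mono h3 ?_) (hK.mono h4 ?_)))) ?_
  · intros; omega
  · intros; omega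
  · intros; omega
  · intros; omega
  · simp only [G]; abel

/-- A chord-like chain on ring `i` at position `m`. -/
def Chd (K : (ℕ → ℕ → Prop) → ℕ → ℕ → ℕ → ℕ → W → Prop) (n i m : ℕ) (C : ℕ → ℕ → Prop) (c : W) :
    Prop :=
  K C i m i (m + n) c ∧ ∀ y, C i y → y = m ∨ y = m + n

/-- closing up a chord along ring `i` -/
def cl (n : ℕ) (R : ℕ → ℕ → W) (i m : ℕ) (c : W) : W := c + pre R i m + pre R i (m + n)

theorem tri (hK : KS ω t n N K R Sp wr E) (hN : 2 * n ≤ N) {i : ℕ} (hi : i < t)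
    {j k l : ℕ} (hjk : j < k) (hkl : k < l) (hl : l < n) {C1 C2 C3 : ℕ → ℕ → Prop} {c1 c2 c3 : W}
    (K1 : Chd K n i j C1 c1) (K2 : Chd K n i k C2 c2) (K3 : Chd K n i l C3 c3)
    (d1 : ∀ i x, C1 i x → C2 i x → False) (d2 : ∀ i x, C1 i x → C3 i x → False)
    (d3 : ∀ i x, C2 i x → C3 i x → False) :
    ω (cl n R i j c1) (cl n R i k c2) + ω (cl n R i k c2) (cl n R i l c3)
      + ω (cl n R i j c1) (cl n R i l c3) + ω (rg N R wr i) (cl n R i k c2) = 1 := by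
  have h1 := hK.arc hi (show j ≤ k by omega) (by omega)
  have h2 := hK.arc hi (show k ≤ l by omega) (by omega)
  have h3 := hK.arc hi (show l ≤ j + n by omega) (by omega)
  have h4 := hK.arc hi (show j + n ≤ k + n by omega) (by omega)
  have h5 := hK.arc hi (show k + n ≤ l + n by omega) (by omega)
  have h6 := hK.coarc hi (show j ≤ l + n by omega) (by omega)
  have key := hK.k33 h1 h2 h3 h4 h5 h6 K1.1 K2.1 K3.1 d1 d2 d3
    (by rintro a x hC ⟨rfl, hx⟩; have := K1.2 x hC; omega)
    (by rintro a x hC ⟨rfl, hx⟩; have := K1.2 x hC; omega)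
    (by rintro a x hC ⟨rfl, hx⟩; have := K2.2 x hC; omega)
    (by rintro a x hC ⟨rfl, hx⟩; have := K2.2 x hC; omega)
    (by rintro a x hC ⟨rfl, hx⟩; have := K3.2 x hC; omega)
    (by rintro a x hC ⟨rfl, hx⟩; have := K3.2 x hC; omega)
    (by intros; omega) (by intros; omega) (by intros; omega) (by intros; omega)
    (by intros; omega) (by intros; omega) (by intros; omega) (by intros; omega)
    (by intros; omega)
  have e1 : cl n R i j c1 = c1 + (pre R i j + pre R i k) + (pre R i k + pre R i l)
      + (pre R i l + pre R i (j + n)) := by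
    rw [cl, ← sub_eq_zero]
    have a1 := dblW (pre R i k)
    have a2 := dblW (pre R i l)
    linear_combination (norm := module) -a1 - a2
  have e2 : cl n R i k c2 = c2 + (pre R i k + pre R i l) + (pre R i l + pre R i (j + n))
      + (pre R i (j + n) + pre R i (k + n)) := by
    rw [cl, ← sub_eq_zero]
    have a1 := dblW (pre R i (j + n))
    have a2 := dblW (pre R i l)
    linear_combination (norm := module) -a1 - a2
  have e3 : cl n R i l c3 = c3 + (pre R i l + pre R i (j + n)) + (pre R i (j + n) + pre R i (k + n))
      + (pre R i (k + n) + pre R i (l + n)) := by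
    rw [cl, ← sub_eq_zero]
    have a1 := dblW (pre R i (j + n))
    have a2 := dblW (pre R i (k + n))
    linear_combination (norm := module) -a1 - a2
  have e4 : rg N R wr i = (pre R i j + pre R i k) + (pre R i k + pre R i l)
      + (pre R i l + pre R i (j + n)) + (pre R i (j + n) + pre R i (k + n))
      + (pre R i (k + n) + pre R i (l + n)) + (rg N R wr i + pre R i j + pre R i (l + n)) := by
    rw [← sub_eq_zero]
    have a0 := dblW (pre R i j)
    have a1 := dblW (pre R i k)
    have a2 := dblW (pre R i l)
    have a3 := dblW (pre R i (j + n))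
    have a4 := dblW (pre R i (k + n))
    have a5 := dblW (pre R i (l + n))
    linear_combination (norm := module) -a0 - a1 - a2 - a3 - a4 - a5
  rw [e1, e2, e3]
  conv_lhs => rw [e4]
  exact key

theorem tri' (hK : KS ω t n N K R Sp wr E) (hsym : ∀ x y, ω x y = ω y x)
    (hN : 2 * n ≤ N) {i : ℕ} (hi : i < t)
    {j k l : ℕ} (hj : j < n) (hk : k < n) (hl : l < n) (hjk : j ≠ k) (hkl : k ≠ l) (hjl : j ≠ l)
    {C1 C2 C3 : ℕ → ℕ → Prop} {c1 c2 c3 : W}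
    (K1 : Chd K n i j C1 c1) (K2 : Chd K n i k C2 c2) (K3 : Chd K n i l C3 c3)
    (d1 : ∀ i x, C1 i x → C2 i x → False) (d2 : ∀ i x, C1 i x → C3 i x → False)
    (d3 : ∀ i x, C2 i x → C3 i x → False)
    (z1 : ω (rg N R wr i) (cl n R i j c1) = 0) (z2 : ω (rg N R wr i) (cl n R i k c2) = 0)
    (z3 : ω (rg N R wr i) (cl n R i l c3) = 0) :
    ω (cl n R i j c1) (cl n R i k c2) + ω (cl n R i k c2) (cl n R i l c3)
      + ω (cl n R i j c1) (cl n R i l c3) = 1 := by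
  have d1' : ∀ i x, C2 i x → C1 i x → False := fun i x a b => d1 i x b a
  have d2' : ∀ i x, C3 i x → C1 i x → False := fun i x a b => d2 i x b a
  have d3' : ∀ i x, C3 i x → C2 i x → False := fun i x a b => d3 i x b a
  have s1 := hsym (cl n R i j c1) (cl n R i k c2)
  have s2 := hsym (cl n R i k c2) (cl n R i l c3)
  have s3 := hsym (cl n R i j c1) (cl n R i l c3)
  rcases lt_or_gt_of_ne hjk with h1 | h1 <;> rcases lt_or_gt_of_ne hkl with h2 | h2 <;>
    rcases lt_or_gt_of_ne hjl with h3 | h3 <;> try omega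
  · have := hK.tri hN hi h1 h2 hl K1 K2 K3 d1 d2 d3
    linear_combination this - z2
  · have := hK.tri hN hi h3 h2 hk K1 K3 K2 d2 d1 d3'
    linear_combination this - z3 + s2
  · have := hK.tri hN hi h3 h1 hk K3 K1 K2 d2' d3' d1
    linear_combination this - z1 + s3 + s2
  · have := hK.tri hN hi h1 h3 hl K2 K1 K3 d1' d3 d2
    linear_combination this - z1 + s1
  · have := hK.tri hN hi h2 h3 hj K2 K3 K1 d3 d1' d2'
    linear_combination this - z3 + s1 + s3
  · have := hK.tri hN hi h2 h1 hj K3 K2 K1 d3' d2' d1'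
    linear_combination this - z2 + s1 + s2 + s3

end KS

end Core

section Core2

variable {W : Type*} [AddCommGroup W] [Module (ZMod 2) W]

namespace KS

variable {ω : W →ₗ[ZMod 2] W →ₗ[ZMod 2] ZMod 2} {t n N : ℕ}
    {K : (ℕ → ℕ → Prop) → ℕ → ℕ → ℕ → ℕ → W → Prop} {R Sp : ℕ → ℕ → W} {wr E : ℕ → W}

/-- closed up extended chord -/
def qq (n : ℕ) (R Sp : ℕ → ℕ → W) (E : ℕ → W) (i j : ℕ) : W := cl n R i j (Qv n Sp E i j)

theorem qcl (hK : KS ω t n N K R Sp wr E) (hN : 2 * n ≤ N) {i j : ℕ} (hi : i < t) (hj : j < n) :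
    K (fun x y => (x ≤ i ∧ (y = j ∨ y = j + n)) ∨ (x = i ∧ j ≤ y ∧ y ≤ j + n)) i j i j
      (qq n R Sp E i j) := by
  refine hK.cast (hK.trans (hK.mono (hK.qch hN hi hj) ?_)
    (hK.mono (hK.symm (hK.arc hi (show j ≤ j + n by omega) (by omega))) ?_)) ?_
  · intros; omega
  · intros; omega
  · rw [qq, cl]; abel

theorem qcl' (hK : KS ω t n N K R Sp wr E) (hN : 2 * n ≤ N) {i j : ℕ} (hi : i < t) (hj : j < n) :
    K (fun x y => (x ≤ i ∧ (y = j ∨ y = j + n)) ∨ (x = i ∧ (y ≤ j ∨ (j + n ≤ y ∧ y < N)))) i j i j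
      (rg N R wr i + qq n R Sp E i j) := by
  refine hK.cast (hK.trans (hK.mono (hK.qch hN hi hj) ?_)
    (hK.mono (hK.coarc hi (show j ≤ j + n by omega) (by omega)) ?_)) ?_
  · intros; omega
  · intros; omega
  · rw [qq, cl]; abel

theorem qchd (hK : KS ω t n N K R Sp wr E) (hN : 2 * n ≤ N) {i j : ℕ} (hi : i < t) (hj : j < n) :
    Chd K n i j (fun x y => x ≤ i ∧ (y = j ∨ y = j + n)) (Qv n Sp E i j) :=
  ⟨hK.qch hN hi hj, by intros; omega⟩

theorem eq_of_add {x y : ZMod 2} (h : x + y = 0) : x = y := by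
  revert x y; decide

theorem gram_of_perp (hK : KS ω t n N K R Sp wr E) (hsym : ∀ x y, ω x y = ω y x)
    (hN : 2 * n ≤ N) {i : ℕ} (hi : i < t) (hn : 0 < n)
    (h0 : ∀ j, j < n → ω (rg N R wr i) (qq n R Sp E i j) = 0) :
    ∃ s : Fin n → ZMod 2, ∀ j k : Fin n, j ≠ k →
      ω (qq n R Sp E i j) (qq n R Sp E i k) = 1 + s j + s k := by
  refine ⟨fun j => if (j : ℕ) = 0 then 0 else 1 + ω (qq n R Sp E i 0) (qq n R Sp E i j), ?_⟩
  intro j k hjk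
  have hjk' : (j : ℕ) ≠ k := fun h => hjk (Fin.ext h)
  have e : (1 : ZMod 2) + 1 = 0 := rfl
  by_cases hj : (j : ℕ) = 0
  · have hk : (k : ℕ) ≠ 0 := by omega
    simp only [hj, hk, if_true, if_false]
    linear_combination -e
  by_cases hk : (k : ℕ) = 0
  · simp only [hj, hk, if_true, if_false]
    rw [hsym]
    linear_combination -e
  · simp only [hj, hk, if_false]
    have := hK.tri' hsym hN hi (j := 0) (k := j) (l := k) hn j.2 k.2 (by omega) hjk' (by omega)
      (hK.qchd hN hi hn) (hK.qchd hN hi j.2) (hK.qchd hN hi k.2)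
      (by intros; omega) (by intros; omega) (by intros; omega)
      (h0 _ hn) (h0 _ j.2) (h0 _ k.2)
    simp only [qq]
    linear_combination this - e - dbl2 (ω (cl n R i 0 (Qv n Sp E i 0)) (cl n R i j (Qv n Sp E i j)))
      - dbl2 (ω (cl n R i 0 (Qv n Sp E i 0)) (cl n R i k (Qv n Sp E i k)))

theorem ladq (hK : KS ω t n N K R Sp wr E) (hN : 2 * n ≤ N) {i i' p q m : ℕ} (hi : i + 1 < t)
    (hi' : i' < t) (h0 : rg N R wr i' = 0) (hm : m < n) (hpq : p ≤ q) (hq : q < N)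
    (h : (m < p ∧ q < m + n) ∨ q < m ∨ m + n < p) :
    ω (G R Sp i p + G R Sp i q) (qq n R Sp E i' m) = 0 := by
  rcases h with h | h
  · have h1 := hK.qcl' hN hi' hm
    rw [h0, zero_add] at h1
    exact hK.inter0 (hK.lad hi hpq hq) h1 (by intros; omega)
  · exact hK.inter0 (hK.lad hi hpq hq) (hK.qcl hN hi' hm) (by intros; omega)

theorem lchd (hK : KS ω t n N K R Sp wr E) (hN : 2 * n ≤ N) {i k : ℕ} (hi : i + 1 < t)
    (hk : k < n) :
    Chd K n i k (fun x y => (x = i ∧ (y = k ∨ y = k + n)) ∨ (x = i + 1 ∧ k ≤ y ∧ y ≤ k + n))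
      (Sp i k + ((pre R (i + 1) k + pre R (i + 1) (k + n)) + Sp i (k + n))) := by
  refine ⟨hK.trans (hK.mono (hK.spoke i k hi (by omega)) ?_)
    (hK.trans (hK.mono (hK.arc hi (show k ≤ k + n by omega) (by omega)) ?_)
      (hK.mono (hK.symm (hK.spoke i (k + n) hi (by omega))) ?_)), ?_⟩
  all_goals intros; omega

/-- closed chord through the next ring -/
def ll (n : ℕ) (R Sp : ℕ → ℕ → W) (i k : ℕ) : W := G R Sp i k + G R Sp i (k + n)

theorem ll_eq (i k : ℕ) :
    cl n R i k (Sp i k + ((pre R (i + 1) k + pre R (i + 1) (k + n)) + Sp i (k + n)))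
      = ll n R Sp i k := by
  simp only [cl, ll, G]; abel

theorem llq (hK : KS ω t n N K R Sp wr E) (hN : 2 * n ≤ N) {i m k k' : ℕ} (hi : i + 1 < t)
    (h0 : rg N R wr i = 0) (hm : m < n) (hk : k < n) (hk' : k' < n) (hkm : k ≠ m) (hkm' : k' ≠ m) :
    ω (ll n R Sp i k) (qq n R Sp E i m) = ω (ll n R Sp i k') (qq n R Sp E i m) := by
  have hi' : i < t := by omega
  have hin : ∀ p q, m < p → p < m + n → m < q → q < m + n →
      ω (G R Sp i p) (qq n R Sp E i m) = ω (G R Sp i q) (qq n R Sp E i m) := by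
    have : ∀ p q, m < p → q < m + n → p ≤ q →
        ω (G R Sp i p) (qq n R Sp E i m) = ω (G R Sp i q) (qq n R Sp E i m) := by
      intro p q h1 h2 h3
      have := hK.ladq hN hi hi' h0 hm h3 (by omega) (Or.inl ⟨h1, h2⟩)
      rw [map_add, LinearMap.add_apply] at this
      exact eq_of_add this
    intro p q h1 h2 h3 h4
    rcases le_total p q with h | h
    · exact this p q h1 h4 h
    · exact (this q p h3 h2 h).symm
  have hout : ∀ p q, q < N → (p < m ∨ m + n < p) → (q < m ∨ m + n < q) → p ≤ q →
      ω (G R Sp i p) (qq n R Sp E i m) = ω (G R Sp i q) (qq n R Sp E i m) := by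
    intro p q hq h1 h2 h3
    by_cases h4 : p < m ∧ m + n < q
    · have e1 := hK.inter0 (hK.colad hi h3 hq) (hK.qcl hN hi' hm) (by intros; omega)
      have e2 := hK.inter0 (hK.full hi (by omega)) (hK.qcl hN hi' hm) (by intros; omega)
      rw [h0, add_zero, map_add, LinearMap.add_apply, e2, add_zero, map_add,
        LinearMap.add_apply] at e1
      exact eq_of_add e1
    · have := hK.ladq hN hi hi' h0 hm h3 (by omega) (by omega)
      rw [map_add, LinearMap.add_apply] at this
      exact eq_of_add this
  have hout' : ∀ p q, p < N → q < N → (p < m ∨ m + n < p) → (q < m ∨ m + n < q) →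
      ω (G R Sp i p) (qq n R Sp E i m) = ω (G R Sp i q) (qq n R Sp E i m) := by
    intro p q hp hq h1 h2
    rcases le_total p q with h | h
    · exact hout p q hq h1 h2 h
    · exact (hout q p hp h2 h1 h).symm
  simp only [ll, map_add, LinearMap.add_apply]
  rcases lt_or_gt_of_ne hkm with h | h <;> rcases lt_or_gt_of_ne hkm' with h' | h'
  · rw [hout' k k', hin (k + n) (k' + n)] <;> omega
  · rw [hout' k (k' + n), hin (k + n) k'] <;> first | omega | ring
  · rw [hin k (k' + n), hout' (k + n) k'] <;> first | omega | ring
  · rw [hin k k', hout' (k + n) (k' + n)] <;> omega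

theorem inner [FiniteDimensional (ZMod 2) W] (hK : KS ω t n N K R Sp wr E) (hω : ∀ x, ω x x = 0)
    (hsym : ∀ x y, ω x y = ω y x) (hN : 2 * n ≤ N) {i : ℕ} (hi : i + 1 < t)
    (hd : Module.finrank (ZMod 2) W + 2 ≤ n) (hn : 3 ≤ n) (h0 : rg N R wr i = 0) : False := by
  have hi' : i < t := by omega
  set s : Fin n → ZMod 2 := fun m =>
    ω (ll n R Sp i (if (m : ℕ) = 0 then 1 else 0)) (qq n R Sp E i m) with hs
  have hls : ∀ k m : Fin n, k ≠ m → ω (ll n R Sp i k) (qq n R Sp E i m) = s m := by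
    intro k m hkm
    have hkm' : (k : ℕ) ≠ m := fun h => hkm (Fin.ext h)
    exact hK.llq hN hi h0 m.2 k.2 (by split_ifs <;> omega) hkm' (by split_ifs <;> omega)
  have hz : ∀ w, ω (rg N R wr i) w = 0 := by intro w; rw [h0]; simp
  have hgram : ∀ j k : Fin n, j ≠ k →
      ω (qq n R Sp E i j) (qq n R Sp E i k) = 1 + s j + s k := by
    intro j k hjk
    have hjk' : (j : ℕ) ≠ k := fun h => hjk (Fin.ext h)
    obtain ⟨l, hl, hlj, hlk⟩ : ∃ l, l < n ∧ l ≠ (j : ℕ) ∧ l ≠ (k : ℕ) := by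
      by_cases a : (0 : ℕ) ≠ j ∧ 0 ≠ (k : ℕ)
      · exact ⟨0, by omega, a⟩
      by_cases b : (1 : ℕ) ≠ j ∧ 1 ≠ (k : ℕ)
      · exact ⟨1, by omega, b⟩
      · exact ⟨2, by omega, by omega, by omega⟩
    have := hK.tri' hsym hN hi' j.2 k.2 hl hjk' hlk.symm hlj.symm
      (hK.qchd hN hi' j.2) (hK.qchd hN hi' k.2) (hK.lchd hN hi hl)
      (by intros; omega) (by intros; omega) (by intros; omega) (hz _) (hz _) (hz _)
    rw [ll_eq] at this
    have e1 := hls ⟨l, hl⟩ j (fun h => hlj (congrArg Fin.val h))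
    have e2 := hls ⟨l, hl⟩ k (fun h => hlk (congrArg Fin.val h))
    rw [hsym] at e1 e2
    simp only [qq] at e1 e2 ⊢
    linear_combination this + e1 + e2 - dbl2 (ω (cl n R i k (Qv n Sp E i k)) (ll n R Sp i l))
      - dbl2 (ω (cl n R i j (Qv n Sp E i j)) (ll n R Sp i l))
  obtain ⟨-, h1, h2, k, hk⟩ := gram_lemma ω hω (fun j : Fin n => qq n R Sp E i j) s hgram hd
  have h3 : ω (ll n R Sp i k) (∑ j : Fin n, s j • qq n R Sp E i j) = ∑ j, s j := by
    rw [map_sum]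
    refine Finset.sum_congr rfl fun j _ => ?_
    rw [map_smul, smul_eq_mul]
    by_cases hj : k = j
    · subst hj; rw [hk, zero_mul]
    · rw [hls k j hj]; generalize s j = x; revert x; decide
  rw [h1, map_zero, h2] at h3
  exact absurd h3 (by decide)

theorem outer [FiniteDimensional (ZMod 2) W] (hK : KS ω t n N K R Sp wr E) (hω : ∀ x, ω x x = 0)
    (hN : 2 * n ≤ N) {i : ℕ} (hi : i + 1 < t)
    (hd : Module.finrank (ZMod 2) W + 2 ≤ n) (hn : 3 ≤ n) (h0 : rg N R wr (i + 1) = 0)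
    (s : Fin n → ZMod 2) (hgram : ∀ j k : Fin n, j ≠ k →
      ω (qq n R Sp E (i + 1) j) (qq n R Sp E (i + 1) k) = 1 + s j + s k) : False := by
  have hperp : ∀ j m, j + 1 < n → m < n → m ≠ j → m ≠ j + 1 →
      ω (qq n R Sp E (i + 1) j) (qq n R Sp E (i + 1) m)
        = ω (qq n R Sp E (i + 1) (j + 1)) (qq n R Sp E (i + 1) m) := by
    intro j m hj hm h1 h2
    apply eq_of_add
    rw [← LinearMap.add_apply, ← map_add]
    have Z : K (fun x y => x ≤ i ∧ (y = j ∨ y = j + 1 ∨ y = j + n ∨ y = j + 1 + n)) i j i j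
        (Qv n Sp E i j + ((pre R i (j + n) + pre R i (j + 1 + n)) + (Qv n Sp E i (j + 1)
          + (pre R i j + pre R i (j + 1))))) := by
      refine hK.trans (hK.mono (hK.qch hN (show i < t by omega) (show j < n by omega)) ?_)
        (hK.trans (hK.mono (hK.arc (show i < t by omega) (show j + n ≤ j + 1 + n by omega)
          (by omega)) ?_)
        (hK.trans (hK.mono (hK.symm (hK.qch hN (show i < t by omega) hj)) ?_)
        (hK.mono (hK.symm (hK.arc (show i < t by omega) (show j ≤ j + 1 by omega)
          (by omega))) ?_)))
      all_goals intros; omega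
    have e1 := hK.inter0 Z (hK.qcl hN hi hm) (by intros; omega)
    have e2 := hK.ladq hN hi hi h0 hm (show j ≤ j + 1 by omega) (by omega) (by omega)
    have e3 := hK.ladq hN hi hi h0 hm (show j + n ≤ j + 1 + n by omega) (by omega) (by omega)
    have e4 : qq n R Sp E (i + 1) j + qq n R Sp E (i + 1) (j + 1) =
        (Qv n Sp E i j + ((pre R i (j + n) + pre R i (j + 1 + n)) + (Qv n Sp E i (j + 1)
          + (pre R i j + pre R i (j + 1)))))
        + (G R Sp i j + G R Sp i (j + 1)) + (G R Sp i (j + n) + G R Sp i (j + 1 + n)) := by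
      rw [← sub_eq_zero]
      have a1 := dblW (pre R i j)
      have a2 := dblW (pre R i (j + 1))
      have a3 := dblW (pre R i (j + n))
      have a4 := dblW (pre R i (j + 1 + n))
      simp only [qq, cl, Qv, G]
      linear_combination (norm := module) -a1 - a2 - a3 - a4
    rw [e4, map_add, map_add, LinearMap.add_apply, LinearMap.add_apply, e1, e2, e3]
    rfl
  have hstep : ∀ (j : ℕ) (hj : j + 1 < n), s ⟨j, by omega⟩ = s ⟨j + 1, hj⟩ := by
    intro j hj
    obtain ⟨m, hm, hmj, hmk⟩ : ∃ m, m < n ∧ m ≠ j ∧ m ≠ j + 1 := by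
      by_cases a : (0 : ℕ) ≠ j
      · exact ⟨0, by omega, a, by omega⟩
      · exact ⟨2, by omega, by omega, by omega⟩
    have e := hperp j m hj hm hmj hmk
    have e1 := hgram ⟨j, by omega⟩ ⟨m, hm⟩ (fun h => hmj (congrArg Fin.val h).symm)
    have e2 := hgram ⟨j + 1, hj⟩ ⟨m, hm⟩ (fun h => hmk (congrArg Fin.val h).symm)
    simp only at e1 e2
    linear_combination e + e2 - e1
  have hconst : ∀ (j : ℕ) (hj : j < n), s ⟨j, hj⟩ = s ⟨0, by omega⟩ := by
    intro j
    induction j with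
    | zero => intro _; rfl
    | succ j ih => intro hj; rw [← hstep j hj, ih]
  obtain ⟨-, -, h2, k, hk⟩ := gram_lemma ω hω (fun j : Fin n => qq n R Sp E (i + 1) j) s hgram hd
  have hz : ∀ j, s j = 0 := by
    intro j
    rw [← hk, show s j = _ from hconst j.1 j.2, show s k = _ from hconst k.1 k.2]
  simp [hz] at h2

theorem core [FiniteDimensional (ZMod 2) W] (hK : KS ω t n N K R Sp wr E) (hω : ∀ x, ω x x = 0)
    (hsym : ∀ x y, ω x y = ω y x) (hnd : ∀ a, (∀ w, ω a w = 0) → a = 0) (ht : 2 ≤ t)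
    (hn : n = 2 * t) (hN : 2 * n ≤ N) (hd : Module.finrank (ZMod 2) W + 2 = 2 * t) : False := by
  have h00 : ∀ i j : Fin t, ω (rg N R wr i) (rg N R wr j) = 0 := by
    intro i j
    by_cases h : i = j
    · subst h; exact hω _
    · have h' : (i : ℕ) ≠ j := fun e => h (Fin.ext e)
      exact hK.inter0 (hK.full i.2 (by omega)) (hK.full j.2 (by omega)) (by intros; omega)
  have hli : ¬ LinearIndependent (ZMod 2) (fun i : Fin t => rg N R wr i) := by
    intro h
    have := isotropic_bound ω hsym hnd _ h h00
    omega
  rw [Fintype.not_linearIndependent_iff] at hli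
  obtain ⟨g, hg, i1, hi1⟩ := hli
  obtain ⟨i0, hi0, hmin⟩ := (wellFounded_lt (α := Fin t)).has_min {i | g i ≠ 0} ⟨i1, hi1⟩
  have hperp : ∀ j, j < n → ω (rg N R wr i0) (qq n R Sp E i0 j) = 0 := by
    intro j hj
    have h1 : ω (∑ i, g i • rg N R wr (i : ℕ)) (qq n R Sp E i0 j) = 0 := by rw [hg]; simp
    rw [map_sum, LinearMap.sum_apply, Finset.sum_eq_single i0] at h1
    · rw [map_smul, LinearMap.smul_apply, smul_eq_mul] at h1
      exact (mul_eq_zero.1 h1).resolve_left hi0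
    · intro b _ hb
      rw [map_smul, LinearMap.smul_apply, smul_eq_mul]
      rcases lt_or_gt_of_ne hb with h | h
      · have : g b = 0 := by
          by_contra hc
          exact hmin b hc h
        rw [this, zero_mul]
      · have h' : (i0 : ℕ) < b := h
        rw [hK.inter0 (hK.full b.2 (by omega)) (hK.qcl hN i0.2 hj) (by intros; omega), mul_zero]
    · intro h; exact absurd (Finset.mem_univ _) h
  obtain ⟨s, hs⟩ := hK.gram_of_perp hsym hN i0.2 (by omega) hperp
  obtain ⟨h1, -⟩ := gram_lemma ω hω (fun j : Fin n => qq n R Sp E i0 j) s hs (by omega)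
  have ha : rg N R wr i0 = 0 := hnd _ (h1 _ fun j => hperp j j.2)
  have hi0t := i0.2
  generalize (i0 : ℕ) = i at *
  by_cases hin : i + 1 < t
  · exact hK.inner hω hsym hN hin (by omega) (by omega) ha
  · obtain ⟨i', rfl⟩ : ∃ i', i = i' + 1 := ⟨i - 1, by omega⟩
    exact hK.outer hω hN hi0t (by omega) (by omega) ha s hs

end KS

end Core2

set_option linter.unusedSimpArgs false
set_option linter.unusedVariables false
/-! ### The drawing of the orientable grid -/

section Drawing

/-- homology of the closed orientable surface of genus `g` -/
abbrev HW (g : ℕ) := (Fin g → ZMod 2) × (Fin g → ZMod 2)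

/-- intersection form -/
def om (g : ℕ) : HW g →ₗ[ZMod 2] HW g →ₗ[ZMod 2] ZMod 2 :=
  LinearMap.mk₂ (ZMod 2) (fun x y => ∑ p, (x.1 p * y.2 p + x.2 p * y.1 p))
    (by intro a b c; rw [← Finset.sum_add_distrib]
        exact Finset.sum_congr rfl fun p _ => by simp only [Prod.fst_add, Prod.snd_add, Pi.add_apply]; ring)
    (by intro c a b; rw [Finset.smul_sum]
        exact Finset.sum_congr rfl fun p _ => by
          simp only [Prod.smul_fst, Prod.smul_snd, Pi.smul_apply, smul_eq_mul]; ring)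
    (by intro a b c; rw [← Finset.sum_add_distrib]
        exact Finset.sum_congr rfl fun p _ => by simp only [Prod.fst_add, Prod.snd_add, Pi.add_apply]; ring)
    (by intro c a b; rw [Finset.smul_sum]
        exact Finset.sum_congr rfl fun p _ => by
          simp only [Prod.smul_fst, Prod.smul_snd, Pi.smul_apply, smul_eq_mul]; ring)

theorem om_apply (g : ℕ) (x y : HW g) : om g x y = ∑ p, (x.1 p * y.2 p + x.2 p * y.1 p) := rfl

theorem om_alt (g : ℕ) (x : HW g) : om g x x = 0 := by
  rw [om_apply]
  refine Finset.sum_eq_zero fun p _ => ?_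
  generalize x.1 p = a
  generalize x.2 p = b
  revert a b; decide

theorem om_symm (g : ℕ) (x y : HW g) : om g x y = om g y x := by
  rw [om_apply, om_apply]
  exact Finset.sum_congr rfl fun p _ => by ring

theorem om_nd (g : ℕ) (a : HW g) (h : ∀ w, om g a w = 0) : a = 0 := by
  ext p
  · have := h (0, Pi.single p 1)
    simpa [om_apply, Pi.single_apply] using this
  · have := h (Pi.single p 1, 0)
    simpa [om_apply, Pi.single_apply] using this

theorem HW_finrank (g : ℕ) : Module.finrank (ZMod 2) (HW g) = 2 * g := by
  rw [Module.finrank_prod, Module.finrank_fin_fun]; ring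

/-- handle generators -/
def hgen (g : ℕ) (p : Fin g) (ty : Bool) : HW g :=
  if ty then (Pi.single p 1, 0) else (0, Pi.single p 1)

theorem om_hgen (g : ℕ) (p p' : Fin g) (ty ty' : Bool) :
    om g (hgen g p ty) (hgen g p' ty') = if p = p' ∧ ty ≠ ty' then 1 else 0 := by
  cases ty <;> cases ty' <;> simp [hgen, om_apply, Pi.single_apply]
  · exact if_congr eq_comm rfl rfl
  · exact if_congr eq_comm rfl rfl

/-- lexicographic order indicator -/
def Lx (v w : ℕ × ℕ) : ZMod 2 := if v.1 < w.1 ∨ (v.1 = w.1 ∧ v.2 < w.2) then 1 else 0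

/-- position of handle edges -/
def HPos (k B : ℕ) (ty : Bool) (a b : ℕ) : Prop :=
  ∃ j, j < k ∧ ((ty = true ∧ a = B + j ∧ b + j + 1 = B + 3 * k) ∨
    (ty = false ∧ a = B + k + j ∧ b + j + 1 = B + 4 * k))

/-- drawn edges -/
inductive DE (k g N : ℕ) : ℕ × ℕ → ℕ × ℕ → HW g → (ℕ × ℕ → ZMod 2) → Prop
  | ring (i c : ℕ) (h : c + 1 < N) : DE k g N (i, c) (i, c + 1) 0 (fun _ => 0)
  | wrap (i : ℕ) : DE k g N (i, N - 1) (i, 0) 0 (fun v => if v.1 ≤ i then 1 else 0)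
  | spoke (i c : ℕ) (h : c < N) : DE k g N (i, c) (i + 1, c) 0
      (fun v => if v.1 = i + 1 ∧ v.2 < c then 1 else 0)
  | hdl (p : Fin g) (ty : Bool) (a b : ℕ) (hN : 4 * k * (p + 1) + 4 * k ≤ N)
      (h : HPos k (4 * k * (p + 1)) ty a b) :
      DE k g N (0, a) (0, b) (hgen g p ty) (fun v => if v.1 = 0 ∧ a < v.2 ∧ v.2 < b then 1 else 0)

theorem pne {a b c d : ℕ} : (a, b) ≠ (c, d) ↔ ¬ (a = c ∧ b = d) := by simp

theorem Lx_tour (a c : ℕ × ℕ) (h : a ≠ c) : Lx a c + Lx c a = 1 := by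
  obtain ⟨a1, a2⟩ := a
  obtain ⟨c1, c2⟩ := c
  rw [pne] at h
  simp only [Lx]
  split_ifs <;> first | rfl | (exfalso; omega)

theorem ring_ring (i c r d : ℕ) (h1 : (i, c) ≠ (r, d)) (h2 : (i, c) ≠ (r, d + 1))
    (h3 : (i, c + 1) ≠ (r, d)) :
    (0 : ZMod 2) = Lx (i, c) (r, d) + Lx (i, c) (r, d + 1) + Lx (i, c + 1) (r, d)
      + Lx (i, c + 1) (r, d + 1) := by
  rw [pne] at *
  simp only [Lx]
  split_ifs <;> first | rfl | (exfalso; omega)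

theorem ring_wrap (N i c r : ℕ) (hc : c + 1 < N) (h1 : (i, c) ≠ (r, N - 1)) (h2 : (i, c) ≠ (r, 0))
    (h3 : (i, c + 1) ≠ (r, N - 1)) :
    (0 : ZMod 2) = Lx (i, c) (r, N - 1) + Lx (i, c) (r, 0) + Lx (i, c + 1) (r, N - 1)
      + Lx (i, c + 1) (r, 0) + (if i ≤ r then 1 else 0) + (if i ≤ r then 1 else 0) := by
  rw [pne] at *
  simp only [Lx]
  split_ifs <;> first | rfl | (exfalso; omega)

theorem ring_spoke (i c r d : ℕ) (h1 : (i, c) ≠ (r, d)) (h2 : (i, c) ≠ (r + 1, d))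
    (h3 : (i, c + 1) ≠ (r, d)) (h4 : (i, c + 1) ≠ (r + 1, d)) :
    (0 : ZMod 2) = Lx (i, c) (r, d) + Lx (i, c) (r + 1, d) + Lx (i, c + 1) (r, d)
      + Lx (i, c + 1) (r + 1, d) + (if i = r + 1 ∧ c < d then 1 else 0)
      + (if i = r + 1 ∧ c + 1 < d then 1 else 0) := by
  rw [pne] at *
  simp only [Lx]
  split_ifs <;> first | rfl | (exfalso; omega)

theorem ring_hdl (i c a b : ℕ) (hab : a < b) (h1 : (i, c) ≠ (0, a)) (h2 : (i, c) ≠ (0, b))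
    (h3 : (i, c + 1) ≠ (0, a)) (h4 : (i, c + 1) ≠ (0, b)) :
    (0 : ZMod 2) = Lx (i, c) (0, a) + Lx (i, c) (0, b) + Lx (i, c + 1) (0, a)
      + Lx (i, c + 1) (0, b) + (if i = 0 ∧ a < c ∧ c < b then 1 else 0)
      + (if i = 0 ∧ a < c + 1 ∧ c + 1 < b then 1 else 0) := by
  rw [pne] at *
  simp only [Lx]
  split_ifs <;> first | rfl | (exfalso; omega)

theorem wrap_wrap (N i r : ℕ) (hN : 2 ≤ N) (h1 : (i, N - 1) ≠ (r, N - 1)) :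
    (0 : ZMod 2) = Lx (i, N - 1) (r, N - 1) + Lx (i, N - 1) (r, 0) + Lx (i, 0) (r, N - 1)
      + Lx (i, 0) (r, 0) + (if r ≤ i then 1 else 0) + (if r ≤ i then 1 else 0)
      + (if i ≤ r then 1 else 0) + (if i ≤ r then 1 else 0) := by
  rw [pne] at *
  simp only [Lx]
  split_ifs <;> first | rfl | (exfalso; omega)

theorem wrap_spoke (N i r d : ℕ) (hd : d < N) (h1 : (i, N - 1) ≠ (r, d))
    (h2 : (i, N - 1) ≠ (r + 1, d)) (h3 : (i, 0) ≠ (r, d)) (h4 : (i, 0) ≠ (r + 1, d)) :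
    (0 : ZMod 2) = Lx (i, N - 1) (r, d) + Lx (i, N - 1) (r + 1, d) + Lx (i, 0) (r, d)
      + Lx (i, 0) (r + 1, d) + (if r ≤ i then 1 else 0) + (if r + 1 ≤ i then 1 else 0)
      + (if i = r + 1 ∧ N - 1 < d then 1 else 0) + (if i = r + 1 ∧ 0 < d then 1 else 0) := by
  rw [pne] at *
  simp only [Lx]
  split_ifs <;> first | rfl | (exfalso; omega)

theorem wrap_hdl (N i a b : ℕ) (hab : a < b) (hb : b < N) (h1 : (i, N - 1) ≠ (0, a))
    (h2 : (i, N - 1) ≠ (0, b)) (h3 : (i, 0) ≠ (0, a)) (h4 : (i, 0) ≠ (0, b)) :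
    (0 : ZMod 2) = Lx (i, N - 1) (0, a) + Lx (i, N - 1) (0, b) + Lx (i, 0) (0, a)
      + Lx (i, 0) (0, b) + (if 0 ≤ i then 1 else 0) + (if 0 ≤ i then 1 else 0)
      + (if i = 0 ∧ a < N - 1 ∧ N - 1 < b then 1 else 0)
      + (if i = 0 ∧ a < 0 ∧ 0 < b then 1 else 0) := by
  rw [pne] at *
  simp only [Lx]
  split_ifs <;> first | rfl | (exfalso; omega)

theorem spoke_spoke (i c r d : ℕ) (h1 : (i, c) ≠ (r, d)) (h2 : (i, c) ≠ (r + 1, d))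
    (h3 : (i + 1, c) ≠ (r, d)) :
    (0 : ZMod 2) = Lx (i, c) (r, d) + Lx (i, c) (r + 1, d) + Lx (i + 1, c) (r, d)
      + Lx (i + 1, c) (r + 1, d)
      + (if r = i + 1 ∧ d < c then 1 else 0) + (if r + 1 = i + 1 ∧ d < c then 1 else 0)
      + (if i = r + 1 ∧ c < d then 1 else 0) + (if i + 1 = r + 1 ∧ c < d then 1 else 0) := by
  rw [pne] at *
  simp only [Lx]
  split_ifs <;> first | rfl | (exfalso; omega)

theorem spoke_hdl (i c a b : ℕ) (hab : a < b) (h1 : (i, c) ≠ (0, a)) (h2 : (i, c) ≠ (0, b)) :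
    (0 : ZMod 2) = Lx (i, c) (0, a) + Lx (i, c) (0, b) + Lx (i + 1, c) (0, a)
      + Lx (i + 1, c) (0, b)
      + (if 0 = i + 1 ∧ a < c then 1 else 0) + (if 0 = i + 1 ∧ b < c then 1 else 0)
      + (if i = 0 ∧ a < c ∧ c < b then 1 else 0) + (if i + 1 = 0 ∧ a < c ∧ c < b then 1 else 0) := by
  rw [pne] at *
  simp only [Lx, lt_self_iff_false, true_and, false_or, Nat.not_lt_zero, false_and, or_false,
    Nat.add_eq_zero_iff, one_ne_zero, and_false, if_false, (Nat.succ_ne_zero _).symm]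
  split_ifs <;> first | rfl | (exfalso; omega)

theorem hdl_hdl (a b c d : ℕ) (hab : a < b) (hcd : c < d) (x : ZMod 2)
    (h : (x = 0 ∧ (b < c ∨ d < a ∨ (a < c ∧ d < b) ∨ (c < a ∧ b < d))) ∨
      (x = 1 ∧ ((a < c ∧ c < b ∧ b < d) ∨ (c < a ∧ a < d ∧ d < b)))) :
    x = Lx (0, a) (0, c) + Lx (0, a) (0, d) + Lx (0, b) (0, c) + Lx (0, b) (0, d)
      + (if 0 = 0 ∧ a < c ∧ c < b then 1 else 0) + (if 0 = 0 ∧ a < d ∧ d < b then 1 else 0)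
      + (if 0 = 0 ∧ c < a ∧ a < d then 1 else 0) + (if 0 = 0 ∧ c < b ∧ b < d then 1 else 0) := by
  simp only [Lx, lt_self_iff_false, true_and, false_or, Nat.not_lt_zero, false_and, or_false,
    Nat.add_eq_zero_iff, one_ne_zero, and_false, if_false, (Nat.succ_ne_zero _).symm]
  rcases h with ⟨rfl, h⟩ | ⟨rfl, h⟩ <;>
  split_ifs <;> first | rfl | (exfalso; omega)

end Drawing

section Good

theorem form_symm {g : ℕ} {a b c d : ℕ × ℕ} {y y' : HW g} {T T' : ℕ × ℕ → ZMod 2}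
    (h1 : a ≠ c) (h2 : a ≠ d) (h3 : b ≠ c) (h4 : b ≠ d)
    (h : om g y y' = Lx a c + Lx a d + Lx b c + Lx b d + T c + T d + T' a + T' b) :
    om g y' y = Lx c a + Lx c b + Lx d a + Lx d b + T' a + T' b + T c + T d := by
  rw [om_symm, h]
  have e : (1 : ZMod 2) + 1 = 0 := rfl
  linear_combination Lx_tour a c h1 + Lx_tour a d h2 + Lx_tour b c h3 + Lx_tour b d h4 + e + e
    - dbl2 (Lx c a) - dbl2 (Lx c b) - dbl2 (Lx d a) - dbl2 (Lx d b)

theorem HPos.lt {k B a b : ℕ} {ty : Bool} (h : HPos k B ty a b) :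
    B ≤ a ∧ a < b ∧ b < B + 4 * k := by
  obtain ⟨j, hj, h | h⟩ := h <;> omega

set_option maxHeartbeats 1000000 in
theorem good_DE (k g N : ℕ) (hN : 2 ≤ N) : Good (om g) Lx (DE k g N) := by
  refine ⟨Lx_tour, ?_⟩
  intro a b y T c d y' T' h h' n1 n2 n3 n4
  have hz : ∀ w : HW g, om g 0 w = 0 := fun w => by simp
  have hz' : ∀ w : HW g, om g w 0 = 0 := fun w => by simp
  cases h with
  | ring i c hc =>
    rw [hz]
    cases h' with
    | ring r d hd => simpa using ring_ring i c r d n1 n2 n3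
    | wrap r => simpa using ring_wrap N i c r hc n1 n2 n3
    | spoke r d hd => simpa using ring_spoke i c r d n1 n2 n3 n4
    | hdl p ty a b hB hp => simpa only [add_zero] using ring_hdl i c a b hp.lt.2.1 n1 n2 n3 n4
  | wrap i =>
    cases h' with
    | ring r d hd =>
      refine form_symm (T := (fun _ => 0))
        (T' := (fun v => if v.1 ≤ i then 1 else 0)) n1.symm n3.symm n2.symm n4.symm ?_
      rw [hz]
      simpa only [add_zero] using ring_wrap N r d i hd n1.symm n3.symm n2.symm
    | wrap r => rw [hz]; exact wrap_wrap N i r hN n1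
    | spoke r d hd => rw [hz]; exact wrap_spoke N i r d hd n1 n2 n3 n4
    | hdl p ty a b hB hp =>
      rw [hz]; exact wrap_hdl N i a b hp.lt.2.1 (by have := hp.lt; omega) n1 n2 n3 n4
  | spoke i c hc =>
    cases h' with
    | ring r d hd =>
      refine form_symm (T := (fun _ => 0))
        (T' := (fun v => if v.1 = i + 1 ∧ v.2 < c then 1 else 0)) n1.symm n3.symm n2.symm n4.symm ?_
      rw [hz]
      simpa only [add_zero] using ring_spoke r d i c n1.symm n3.symm n2.symm n4.symm
    | wrap r =>
      refine form_symm (T := (fun v => if v.1 ≤ r then 1 else 0))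
        (T' := (fun v => if v.1 = i + 1 ∧ v.2 < c then 1 else 0)) n1.symm n3.symm n2.symm n4.symm ?_
      rw [hz]
      exact wrap_spoke N r i c hc n1.symm n3.symm n2.symm n4.symm
    | spoke r d hd => rw [hz]; exact spoke_spoke i c r d n1 n2 n3
    | hdl p ty a b hB hp =>
      rw [hz]; exact spoke_hdl i c a b hp.lt.2.1 n1 n2
  | hdl p ty a b hB hp =>
    cases h' with
    | ring r d hd =>
      refine form_symm (T := (fun _ => 0))
        (T' := (fun v => if v.1 = 0 ∧ a < v.2 ∧ v.2 < b then 1 else 0)) n1.symm n3.symm n2.symm n4.symm ?_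
      rw [hz]
      simpa only [add_zero] using ring_hdl r d a b hp.lt.2.1 n1.symm n3.symm n2.symm n4.symm
    | wrap r =>
      refine form_symm (T := (fun v => if v.1 ≤ r then 1 else 0))
        (T' := (fun v => if v.1 = 0 ∧ a < v.2 ∧ v.2 < b then 1 else 0)) n1.symm n3.symm n2.symm n4.symm ?_
      rw [hz]
      exact wrap_hdl N r a b hp.lt.2.1 (by have := hp.lt; omega) n1.symm n3.symm n2.symm n4.symm
    | spoke r d hd =>
      refine form_symm (T := (fun v => if v.1 = r + 1 ∧ v.2 < d then 1 else 0))
        (T' := (fun v => if v.1 = 0 ∧ a < v.2 ∧ v.2 < b then 1 else 0)) n1.symm n3.symm n2.symm n4.symm ?_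
      rw [hz]; exact spoke_hdl r d a b hp.lt.2.1 n1.symm n3.symm
    | hdl p' ty' a' b' hB' hp' =>
      refine hdl_hdl a b a' b' hp.lt.2.1 hp'.lt.2.1 _ ?_
      have l1 := hp.lt
      have l2 := hp'.lt
      rw [om_hgen]
      rw [pne] at n1 n2 n3 n4
      rcases lt_trichotomy (p : ℕ) p' with hlt | heq | hgt
      · left
        rw [if_neg (by rintro ⟨rfl, -⟩; omega)]
        refine ⟨rfl, ?_⟩
        have := Nat.mul_le_mul_left (4 * k) (show (p : ℕ) + 1 + 1 ≤ p' + 1 by omega)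
        rw [mul_add _ ((p : ℕ) + 1) 1] at this
        omega
      · obtain rfl : p = p' := Fin.ext heq
        generalize 4 * k * ((p : ℕ) + 1) = B at *
        obtain ⟨j, hj, hp⟩ := hp
        obtain ⟨j', hj', hp'⟩ := hp'
        cases ty <;> cases ty' <;> simp at hp hp' ⊢ <;> omega
      · left
        rw [if_neg (by rintro ⟨rfl, -⟩; omega)]
        refine ⟨rfl, ?_⟩
        have := Nat.mul_le_mul_left (4 * k) (show (p' : ℕ) + 1 + 1 ≤ p + 1 by omega)
        rw [mul_add _ ((p' : ℕ) + 1) 1] at this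
        omega

end Good

section Pull

/-- coordinates of the target grid -/
def phi {k M : ℕ} (v : Fin k × ZMod M) : ℕ × ℕ := (v.1, (v.2 - 1).val)

theorem phi_inj {k M : ℕ} [NeZero M] : Function.Injective (phi : Fin k × ZMod M → ℕ × ℕ) := by
  rintro ⟨i, z⟩ ⟨j, w⟩ h
  simp only [phi, Prod.mk.injEq] at h
  have h2 := ZMod.val_injective M h.2
  rw [sub_left_inj] at h2
  exact Prod.ext (Fin.ext h.1) h2

theorem val_col {M c : ℕ} [NeZero M] {z : ZMod M} (hc : c < M) (m : ℕ) (hm : m = c + 1)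
    (hz : z = ((m : ℕ) : ZMod M)) : (z - 1).val = c := by
  subst hm
  rw [hz]
  push_cast
  rw [add_sub_cancel_right]
  exact ZMod.val_natCast_of_lt hc

theorem val_succ {M : ℕ} [NeZero M] (u : ZMod M) : (u + 1).val = (u.val + 1) % M := by
  conv_lhs => rw [← ZMod.natCast_zmod_val u]
  rw [← Nat.cast_one, ← Nat.cast_add, ZMod.val_natCast]

theorem DE_of_rel {k g : ℕ} [NeZero (4 * (g + 0 + 1) * k)]
    (p q : Fin k × ZMod (4 * (g + 0 + 1) * k))
    (h : (p.1 = q.1 ∧ q.2 = p.2 + 1) ∨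
    (p.2 = q.2 ∧ (q.1 : ℕ) = (p.1 : ℕ) + 1) ∨
    ((p.1 : ℕ) = 0 ∧ (q.1 : ℕ) = 0 ∧ ∃ i ∈ Finset.Icc 2 (g + 1), ∃ j ∈ Finset.Icc 1 k,
      ((p.2 = ((4 * k * (i - 1) + j : ℕ) : ZMod (4 * (g + 0 + 1) * k)) ∧
        q.2 = ((4 * k * (i - 1) + 3 * k - j + 1 : ℕ) : ZMod (4 * (g + 0 + 1) * k))) ∨
       (p.2 = ((4 * k * (i - 1) + k + j : ℕ) : ZMod (4 * (g + 0 + 1) * k)) ∧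
        q.2 = ((4 * k * (i - 1) + 4 * k - j + 1 : ℕ) : ZMod (4 * (g + 0 + 1) * k)))))) :
    ∃ y T, DE k g (4 * (g + 0 + 1) * k) (phi p) (phi q) y T := by
  obtain ⟨i, z⟩ := p
  obtain ⟨r, w⟩ := q
  simp only at h
  have hMpos := Nat.pos_of_ne_zero (NeZero.ne (4 * (g + 0 + 1) * k))
  rcases h with ⟨rfl, rfl⟩ | ⟨rfl, h⟩ | ⟨hi, hr, a, ha, j, hj, h⟩
  · simp only [phi]
    have e : z + 1 - 1 = (z - 1) + 1 := by ring
    rw [e]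
    generalize z - 1 = u
    have hu := ZMod.val_lt u
    have e2 := val_succ u
    by_cases hlt : u.val + 1 < 4 * (g + 0 + 1) * k
    · rw [e2, Nat.mod_eq_of_lt hlt]
      exact ⟨_, _, DE.ring _ _ hlt⟩
    · have e3 : u.val + 1 = 4 * (g + 0 + 1) * k := by omega
      have e4 : u.val = 4 * (g + 0 + 1) * k - 1 := by omega
      rw [e2, e3, Nat.mod_self, e4]
      exact ⟨_, _, DE.wrap _⟩
  · simp only [phi]
    rw [h]
    exact ⟨_, _, DE.spoke _ _ (ZMod.val_lt _)⟩
  · rw [Finset.mem_Icc] at ha hj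
    obtain ⟨p, rfl⟩ : ∃ p, a = p + 2 := ⟨a - 2, by omega⟩
    have hp : p < g := by omega
    have hB : 4 * k * (p + 1) + 4 * k ≤ 4 * (g + 0 + 1) * k := by
      have := Nat.mul_le_mul_left (4 * k) (show p + 1 + 1 ≤ g + 1 by omega)
      calc 4 * k * (p + 1) + 4 * k = 4 * k * (p + 1 + 1) := by ring
        _ ≤ _ := this
        _ = _ := by ring
    have e : p + 2 - 1 = p + 1 := rfl
    rw [e] at h
    simp only [phi, hi, hr]
    rcases h with ⟨h1, h2⟩ | ⟨h1, h2⟩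
    · rw [val_col (c := 4 * k * (p + 1) + (j - 1)) (by omega) _ (by omega) h1,
        val_col (c := 4 * k * (p + 1) + 3 * k - j) (by omega) _ (by omega) h2]
      exact ⟨_, _, DE.hdl ⟨p, hp⟩ true _ _ hB ⟨j - 1, by omega, Or.inl ⟨rfl, rfl, by
        show _ = 4 * k * (p + 1) + _
        omega⟩⟩⟩
    · rw [val_col (c := 4 * k * (p + 1) + k + (j - 1)) (by omega) _ (by omega) h1,
        val_col (c := 4 * k * (p + 1) + 4 * k - j) (by omega) _ (by omega) h2]
      exact ⟨_, _, DE.hdl ⟨p, hp⟩ false _ _ hB ⟨j - 1, by omega, Or.inr ⟨rfl, rfl, by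
        show _ = 4 * k * (p + 1) + _
        omega⟩⟩⟩

theorem DE_of_adj {k g : ℕ} [NeZero (4 * (g + 0 + 1) * k)]
    (p q : Fin k × ZMod (4 * (g + 0 + 1) * k)) (h : (dyckGrid k g 0).Adj p q) :
    ∃ y T, DE k g (4 * (g + 0 + 1) * k) (phi p) (phi q) y T ∨
      DE k g (4 * (g + 0 + 1) * k) (phi q) (phi p) y T := by
  have emp : ¬ ∃ x, x ∈ Finset.Icc (g + 2) (g + 0 + 1) := by
    rintro ⟨x, hx⟩; rw [Finset.mem_Icc] at hx; omega
  rw [dyckGrid, mixedGrid, SimpleGraph.fromRel_adj] at h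
  obtain ⟨-, h | h⟩ := h
  · have : ∃ y T, DE k g (4 * (g + 0 + 1) * k) (phi p) (phi q) y T := by
      apply DE_of_rel
      rcases h with h | h | h | ⟨-, -, i, hi, -⟩
      · exact Or.inl h
      · exact Or.inr (Or.inl h)
      · exact Or.inr (Or.inr h)
      · exact absurd ⟨i, hi⟩ emp
    obtain ⟨y, T, h⟩ := this
    exact ⟨y, T, Or.inl h⟩
  · have : ∃ y T, DE k g (4 * (g + 0 + 1) * k) (phi q) (phi p) y T := by
      apply DE_of_rel
      rcases h with h | h | h | ⟨-, -, i, hi, -⟩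
      · exact Or.inl h
      · exact Or.inr (Or.inl h)
      · exact Or.inr (Or.inr h)
      · exact absurd ⟨i, hi⟩ emp
    obtain ⟨y, T, h⟩ := this
    exact ⟨y, T, Or.inr h⟩

theorem ch_of_adj {k g : ℕ} [NeZero (4 * (g + 0 + 1) * k)]
    {p q : Fin k × ZMod (4 * (g + 0 + 1) * k)} (h : (dyckGrid k g 0).Adj p q)
    {S : Set (ℕ × ℕ)} (hp : phi p ∈ S) (hq : phi q ∈ S) :
    ∃ y T, Ch (DE k g (4 * (g + 0 + 1) * k)) S (phi p) (phi q) y T := by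
  obtain ⟨y, T, h | h⟩ := DE_of_adj p q h
  · exact ⟨y, T, .edge _ _ _ _ hp hq h⟩
  · exact ⟨y, T, .symm _ _ _ _ (.edge _ _ _ _ hq hp h)⟩

theorem ch_of_conn {k g : ℕ} [NeZero (4 * (g + 0 + 1) * k)]
    {X : Set (Fin k × ZMod (4 * (g + 0 + 1) * k))} (h : ((dyckGrid k g 0).induce X).Connected)
    {S : Set (ℕ × ℕ)} (hS : ∀ v ∈ X, phi v ∈ S) {a b} (ha : a ∈ X) (hb : b ∈ X) :
    ∃ y T, Ch (DE k g (4 * (g + 0 + 1) * k)) S (phi a) (phi b) y T := by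
  obtain ⟨w⟩ := h.preconnected ⟨a, ha⟩ ⟨b, hb⟩
  have : ∀ (u v : X), ((dyckGrid k g 0).induce X).Walk u v →
      ∃ y T, Ch (DE k g (4 * (g + 0 + 1) * k)) S (phi u.1) (phi v.1) y T := by
    intro u v w
    induction w with
    | nil => exact ⟨_, _, .nil _ (hS _ (Subtype.property _))⟩
    | cons hadj _ ih =>
      obtain ⟨y, T, h1⟩ := ih
      obtain ⟨y', T', h2⟩ := ch_of_adj (S := S) (SimpleGraph.comap_adj.1 hadj)
        (hS _ (Subtype.property _)) (hS _ (Subtype.property _))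
      exact ⟨_, _, .trans _ _ _ _ _ _ _ h2 h1⟩
  exact this _ _ w

/-- rotated coordinates on the crosscap grid -/
def psi (t : ℕ) [NeZero t] (i c : ℕ) : Fin t × ZMod (4 * (0 + 1 + 1) * t) :=
  (Fin.ofNat t i, ((4 * t + c + 1 : ℕ) : ZMod (4 * (0 + 1 + 1) * t)))

theorem psi_inj {t i c i' c' : ℕ} [NeZero t] (hi : i < t) (hi' : i' < t) (hc : c < 8 * t)
    (hc' : c' < 8 * t) (h : psi t i c = psi t i' c') : i = i' ∧ c = c' := by
  simp only [psi, Prod.mk.injEq] at h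
  obtain ⟨h1, h2⟩ := h
  have h1 := congrArg Fin.val h1
  simp only [Fin.val_ofNat, Nat.mod_eq_of_lt hi, Nat.mod_eq_of_lt hi'] at h1
  refine ⟨h1, ?_⟩
  rw [ZMod.natCast_eq_natCast_iff] at h2
  have h3 : 4 * t + 1 + c ≡ 4 * t + 1 + c' [MOD 8 * t] := by
    have e : 4 * (0 + 1 + 1) * t = 8 * t := by ring
    rw [e] at h2
    convert h2 using 1 <;> ring
  exact (Nat.ModEq.add_left_cancel' _ h3).eq_of_lt_of_lt hc hc'

theorem psi_adj {t : ℕ} [NeZero t] (i c i' c' : ℕ) (hi : i < t) (hi' : i' < t) (hc : c < 8 * t)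
    (hc' : c' < 8 * t) (hne : ¬ (i = i' ∧ c = c'))
    (h : (i = i' ∧ c' = c + 1) ∨ (i = i' ∧ c = 8 * t - 1 ∧ c' = 0) ∨ (i' = i + 1 ∧ c = c') ∨
      (i = 0 ∧ i' = 0 ∧ c < 2 * t ∧ c' = c + 2 * t)) :
    (dyckGrid t 0 1).Adj (psi t i c) (psi t i' c') := by
  rw [dyckGrid, mixedGrid, SimpleGraph.fromRel_adj]
  refine ⟨fun e => hne (psi_inj hi hi' hc hc' e), Or.inl ?_⟩
  simp only [psi, Fin.val_ofNat, Nat.mod_eq_of_lt hi, Nat.mod_eq_of_lt hi']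
  rcases h with ⟨rfl, rfl⟩ | ⟨rfl, h, rfl⟩ | ⟨h, rfl⟩ | ⟨rfl, rfl, h, rfl⟩
  · left
    refine ⟨rfl, ?_⟩
    push_cast; ring
  · left
    refine ⟨rfl, ?_⟩
    have e0 : (((4 * t + c + 1 : ℕ) : ZMod (4 * (0 + 1 + 1) * t)) + 1)
        = ((4 * t + c + 1 + 1 : ℕ) : ZMod (4 * (0 + 1 + 1) * t)) := by push_cast; ring
    rw [e0, ZMod.natCast_eq_natCast_iff]
    have e : 4 * t + c + 1 + 1 = 4 * t + 0 + 1 + 4 * (0 + 1 + 1) * t := by omega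
    rw [e]
    simp [Nat.ModEq]
  · right; left
    exact ⟨rfl, h⟩
  · right; right; right
    refine ⟨rfl, rfl, 2, by simp, c + 1, by rw [Finset.mem_Icc]; omega, ?_, ?_⟩
    · congr 1; omega
    · congr 1; omega

end Pull

section Final

theorem no_minor (t g k : ℕ) (ht : t = g + 1) (hg : 1 ≤ g) (hk : 1 ≤ k) :
    ¬ IsMinorOf (dyckGrid t 0 1) (dyckGrid k g 0) := by
  rintro ⟨X, hdis, hconn, hedge⟩
  have hM : 4 ≤ 4 * (g + 0 + 1) * k := by nlinarith
  have : NeZero (4 * (g + 0 + 1) * k) := ⟨by omega⟩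
  have : NeZero t := ⟨by omega⟩
  have hroot : ∀ v, ∃ x, x ∈ X v := fun v => by
    obtain ⟨x⟩ := (hconn v).nonempty
    exact ⟨x.1, x.2⟩
  choose ρ hρ using hroot
  set D := DE k g (4 * (g + 0 + 1) * k) with hD
  have hG : Good (om g) Lx D := good_DE _ _ _ (by omega)
  let U : (ℕ → ℕ → Prop) → Set (ℕ × ℕ) := fun S =>
    {v | ∃ i c, S i c ∧ i < t ∧ c < 8 * t ∧ ∃ x ∈ X (psi t i c), phi x = v}
  let r : ℕ → ℕ → ℕ × ℕ := fun i c => phi (ρ (psi t i c))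
  let K : (ℕ → ℕ → Prop) → ℕ → ℕ → ℕ → ℕ → HW g → Prop := fun S a b c d y =>
    ∃ T, Ch D (U S) (r a b) (r c d) y T
  have hU : ∀ {S S' : ℕ → ℕ → Prop}, (∀ i x, S i x → S' i x → False) → Disjoint (U S) (U S') := by
    intro S S' h
    rw [Set.disjoint_left]
    rintro v ⟨i, c, hS, hi, hc, x, hx, rfl⟩ ⟨i', c', hS', hi', hc', x', hx', e⟩
    have e' := phi_inj e
    subst e'
    by_cases hne : psi t i c = psi t i' c'
    · obtain ⟨rfl, rfl⟩ := psi_inj hi hi' hc hc' hne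
      exact h _ _ hS hS'
    · exact Set.disjoint_left.1 (hdis _ _ hne) hx hx'
  have hmono : ∀ {S S' : ℕ → ℕ → Prop}, (∀ i x, S i x → S' i x) → U S ⊆ U S' := by
    rintro S S' h v ⟨i, c, hS, hr⟩
    exact ⟨i, c, h _ _ hS, hr⟩
  have hnil : ∀ i c, i < t → c < 8 * t → K (fun x y => x = i ∧ y = c) i c i c 0 := by
    intro i c hi hc
    exact ⟨_, .nil _ ⟨i, c, ⟨rfl, rfl⟩, hi, hc, _, hρ _, rfl⟩⟩
  have hedgeK : ∀ (S : ℕ → ℕ → Prop) (i c i' c' : ℕ), i < t → i' < t → c < 8 * t → c' < 8 * t →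
      S i c → S i' c' → ¬ (i = i' ∧ c = c') →
      ((i = i' ∧ c' = c + 1) ∨ (i = i' ∧ c = 8 * t - 1 ∧ c' = 0) ∨ (i' = i + 1 ∧ c = c') ∨
      (i = 0 ∧ i' = 0 ∧ c < 2 * t ∧ c' = c + 2 * t)) → ∃ y, K S i c i' c' y := by
    intro S i c i' c' hi hi' hc hc' hS hS' hne h
    obtain ⟨a, ha, b, hb, hab⟩ := hedge _ _ (psi_adj i c i' c' hi hi' hc hc' hne h)
    have s1 : ∀ v ∈ X (psi t i c), phi v ∈ U S := fun v hv => ⟨i, c, hS, hi, hc, v, hv, rfl⟩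
    have s2 : ∀ v ∈ X (psi t i' c'), phi v ∈ U S := fun v hv => ⟨i', c', hS', hi', hc', v, hv, rfl⟩
    obtain ⟨y1, T1, h1⟩ := ch_of_conn (hconn _) s1 (hρ _) ha
    obtain ⟨y2, T2, h2⟩ := ch_of_adj hab (s1 a ha) (s2 b hb)
    obtain ⟨y3, T3, h3⟩ := ch_of_conn (hconn _) s2 hb (hρ _)
    exact ⟨_, _, .trans _ _ _ _ _ _ _ h1 (.trans _ _ _ _ _ _ _ h2 h3)⟩
  have eR : ∀ i c, i < t → c + 1 < 8 * t →
      ∃ y, K (fun x y => x = i ∧ (y = c ∨ y = c + 1)) i c i (c + 1) y := by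
    intro i c hi hc
    exact hedgeK _ i c i (c + 1) hi hi (by omega) hc (by omega) (by omega) (by omega) (by omega)
  have eW : ∀ i, i < t →
      ∃ y, K (fun x y => x = i ∧ (y = 0 ∨ y = 8 * t - 1)) i (8 * t - 1) i 0 y := by
    intro i hi
    exact hedgeK _ i _ i 0 hi hi (by omega) (by omega) (by omega) (by omega) (by omega) (by omega)
  have eS : ∀ i c, i + 1 < t → c < 8 * t →
      ∃ y, K (fun x y => (x = i ∨ x = i + 1) ∧ y = c) i c (i + 1) c y := by
    intro i c hi hc
    exact hedgeK _ i c (i + 1) c (by omega) hi hc hc (by omega) (by omega) (by omega) (by omega)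
  have eE : ∀ j, j < 2 * t →
      ∃ y, K (fun x y => x = 0 ∧ (y = j ∨ y = j + 2 * t)) 0 j 0 (j + 2 * t) y := by
    intro j hj
    exact hedgeK _ 0 j 0 (j + 2 * t) (by omega) (by omega) (by omega) (by omega) (by omega)
      (by omega) (by omega) (by omega)
  choose! R hR using eR
  choose! wr hwr using eW
  choose! Sp hSp using eS
  choose! E hE using eE
  have hKS : KS (om g) t (2 * t) (8 * t) K R Sp wr E :=
    { mono := by
        rintro S S' a b c d y ⟨T, h⟩ hS
        exact ⟨T, h.mono (hmono hS)⟩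
      symm := by
        rintro S a b c d y ⟨T, h⟩
        exact ⟨T, .symm _ _ _ _ h⟩
      trans := by
        rintro S a b c d e f y y' ⟨T, h⟩ ⟨T', h'⟩
        exact ⟨_, .trans _ _ _ _ _ _ _ h h'⟩
      nil := hnil
      ring := hR
      wrap := hwr
      spoke := hSp
      chord := hE
      inter0 := by
        rintro S S' a b c d y y' ⟨T, h⟩ ⟨T', h'⟩ hd
        rw [Ch.inter hG (hU hd) h h']
        linear_combination dbl2 (Lx (r a b) (r c d)) + dbl2 (Lx (r a b) (r c d))
          + dbl2 (T (r c d)) + dbl2 (T' (r a b))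
      k33 := by
        rintro a1 a2 a3 a4 a5 a6 b1 b2 b3 b4 b5 b6 H1 H2 H3 H4 H5 H6 C1 C2 C3 h1 h2 h3 h4 h5 h6
          c1 c2 c3 ⟨_, k1⟩ ⟨_, k2⟩ ⟨_, k3⟩ ⟨_, k4⟩ ⟨_, k5⟩ ⟨_, k6⟩ ⟨_, l1⟩ ⟨_, l2⟩ ⟨_, l3⟩
          d1 d2 d3 d4 d5 d6 d7 d8 d9 e1 e2 e3 e4 e5 e6 e7 e8 e9
        exact k33 (om_alt g) (om_symm g) hG k1 k2 k3 k4 k5 k6 l1 l2 l3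
          (hU d1) (hU d2) (hU d3) (hU d4) (hU d5) (hU d6) (hU d7) (hU d8) (hU d9)
          (hU e1) (hU e2) (hU e3) (hU e4) (hU e5) (hU e6) (hU e7) (hU e8) (hU e9) }
  exact hKS.core (om_alt g) (om_symm g) (om_nd g) (by omega) rfl (by omega)
    (by rw [HW_finrank]; omega)

end Final

/-- For every integer `t ≥ 2` and every integer `k ≥ 1`, the Dyck grid
`D_t^{(0,1)}` is not a minor of the Dyck grid `D_k^{(t−1,0)}`. -/
theorem crosscap_dyckGrid_not_minor_orientable (t k : ℕ) (ht : 2 ≤ t) (hk : 1 ≤ k) :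
    ¬ IsMinorOf (dyckGrid t 0 1) (dyckGrid k (t - 1) 0) := by
  exact no_minor t (t - 1) k (by omega) (by omega) hk
end

section
/- Let k, h, c ≥ 1 be integers and let {I'_hdl, I'_crscp} be a partition of [2, h+c+1] with |I'_hdl| = h and |I'_crscp| = c. Suppose i ∈ I'_crscp and i+1 ∈ I'_hdl, and set I_hdl := (I'_hdl \ {i+1}) ∪ {i} and I_crscp := (I'_crscp \ {i}) ∪ {i+1}. Then the mixed surface grid H^{9k}_{I'_hdl,I'_crscp} of order 9k with h handles and c crosscaps contains the mixed surface grid H^k_{I_hdl,I_crscp} of order k with h handles and c crosscaps as a minor. -/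
open SimpleGraph

namespace SwapAux

/-- Zero-based natural number coordinates for the mixed grid relation. -/
def Rel (k M : ℕ) (Ih Ic : Finset ℕ) (p q : ℕ × ℕ) : Prop :=
  (p.1 = q.1 ∧ q.2 = p.2 + 1) ∨
  (p.1 = q.1 ∧ p.2 + 1 = M ∧ q.2 = 0) ∨
  (p.2 = q.2 ∧ q.1 = p.1 + 1) ∨
  (p.1 = 0 ∧ q.1 = 0 ∧ ∃ i ∈ Ih, ∃ j < k,
    ((p.2 = 4 * k * (i - 1) + j ∧ q.2 + j + 1 = 4 * k * (i - 1) + 3 * k) ∨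
     (p.2 = 4 * k * (i - 1) + k + j ∧ q.2 + j + 1 = 4 * k * (i - 1) + 4 * k))) ∨
  (p.1 = 0 ∧ q.1 = 0 ∧ ∃ i ∈ Ic, ∃ j < 2 * k,
    p.2 = 4 * k * (i - 1) + j ∧ q.2 = 4 * k * (i - 1) + 2 * k + j)

/-- Zero-based representative of a column. -/
def phi {N : ℕ} (x : ZMod N) : ℕ := (x - 1).val

lemma phi_cast {N : ℕ} (y : ℕ) (hy : y < N) : phi ((y + 1 : ℕ) : ZMod N) = y := by
  unfold phi
  push_cast
  rw [add_sub_cancel_right, ZMod.val_natCast, Nat.mod_eq_of_lt hy]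

lemma phi_cast' {N : ℕ} (y : ℕ) (h1 : 1 ≤ y) (hy : y ≤ N) : phi ((y : ℕ) : ZMod N) = y - 1 := by
  obtain ⟨z, rfl⟩ : ∃ z, y = z + 1 := ⟨y - 1, by omega⟩
  rw [phi_cast z (by omega)]; rfl

lemma cast_phi {N : ℕ} [NeZero N] (x : ZMod N) : ((phi x + 1 : ℕ) : ZMod N) = x := by
  unfold phi
  push_cast
  rw [ZMod.natCast_zmod_val, sub_add_cancel]

lemma phi_lt {N : ℕ} [NeZero N] (x : ZMod N) : phi x < N := ZMod.val_lt _

lemma phi_succ {N : ℕ} [NeZero N] (x : ZMod N) :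
    phi (x + 1) = phi x + 1 ∨ (phi x + 1 = N ∧ phi (x + 1) = 0) := by
  have h := phi_lt x
  have e : x + 1 = ((phi x + 1 + 1 : ℕ) : ZMod N) := by
    conv_lhs => rw [← cast_phi x]
    push_cast; rfl
  rcases Nat.lt_or_ge (phi x + 1) N with h1 | h1
  · left; conv_lhs => rw [e]
    exact phi_cast _ h1
  · right
    have h2 : phi x + 1 = N := by omega
    refine ⟨h2, ?_⟩
    rw [e, h2]
    unfold phi; simp

lemma block_le (k n i : ℕ) (h2 : 2 ≤ i) (hn : i ≤ n) : 4 * k * (i - 1) + 4 * k ≤ 4 * n * k := by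
  obtain ⟨z, rfl⟩ : ∃ z, i = z + 1 := ⟨i - 1, by omega⟩
  have := Nat.mul_le_mul_left (4 * k) hn
  simp only [Nat.add_sub_cancel]
  nlinarith

/-- Coordinates of a vertex. -/
def co {k N : ℕ} (u : Fin k × ZMod N) : ℕ × ℕ := (u.1.val, phi u.2)

lemma rel_of_adj (k n : ℕ) [NeZero (4 * n * k)] (Ih Ic : Finset ℕ)
    (hIh : ∀ i ∈ Ih, 2 ≤ i ∧ i ≤ n) (hIc : ∀ i ∈ Ic, 2 ≤ i ∧ i ≤ n)
    (u v : Fin k × ZMod (4 * n * k)) (h : (mixedGrid k n Ih Ic).Adj u v) :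
    Rel k (4 * n * k) Ih Ic (co u) (co v) ∨ Rel k (4 * n * k) Ih Ic (co v) (co u) := by
  have key : ∀ p q : Fin k × ZMod (4 * n * k),
    ((p.1 = q.1 ∧ q.2 = p.2 + 1) ∨
    (p.2 = q.2 ∧ (q.1 : ℕ) = (p.1 : ℕ) + 1) ∨
    ((p.1 : ℕ) = 0 ∧ (q.1 : ℕ) = 0 ∧ ∃ i ∈ Ih, ∃ j ∈ Finset.Icc 1 k,
      ((p.2 = ((4 * k * (i - 1) + j : ℕ) : ZMod (4 * n * k)) ∧
        q.2 = ((4 * k * (i - 1) + 3 * k - j + 1 : ℕ) : ZMod (4 * n * k))) ∨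
       (p.2 = ((4 * k * (i - 1) + k + j : ℕ) : ZMod (4 * n * k)) ∧
        q.2 = ((4 * k * (i - 1) + 4 * k - j + 1 : ℕ) : ZMod (4 * n * k))))) ∨
    ((p.1 : ℕ) = 0 ∧ (q.1 : ℕ) = 0 ∧ ∃ i ∈ Ic, ∃ j ∈ Finset.Icc 1 (2 * k),
      p.2 = ((4 * k * (i - 1) + j : ℕ) : ZMod (4 * n * k)) ∧
      q.2 = ((4 * k * (i - 1) + 2 * k + j : ℕ) : ZMod (4 * n * k)))) →
      Rel k (4 * n * k) Ih Ic (co p) (co q) := by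
    rintro ⟨p1, p2⟩ ⟨q1, q2⟩ h
    simp only [co, Rel] at h ⊢
    rcases h with ⟨rfl, rfl⟩ | ⟨rfl, h⟩ | ⟨h1, h2, i, hi, j, hj, h⟩ | ⟨h1, h2, i, hi, j, hj, h, h'⟩
    · rcases phi_succ p2 with h | h
      · left; exact ⟨rfl, h⟩
      · right; left; exact ⟨rfl, h⟩
    · right; right; left; exact ⟨rfl, h⟩
    · right; right; right; left
      have hb := block_le k n i (hIh i hi).1 (hIh i hi).2
      rw [Finset.mem_Icc] at hj
      refine ⟨h1, h2, i, hi, j - 1, by omega, ?_⟩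
      rcases h with ⟨rfl, rfl⟩ | ⟨rfl, rfl⟩
      · left
        rw [phi_cast' _ (by omega) (by omega), phi_cast' _ (by omega) (by omega)]
        omega
      · right
        rw [phi_cast' _ (by omega) (by omega), phi_cast' _ (by omega) (by omega)]
        omega
    · right; right; right; right
      have hb := block_le k n i (hIc i hi).1 (hIc i hi).2
      rw [Finset.mem_Icc] at hj
      refine ⟨h1, h2, i, hi, j - 1, by omega, ?_⟩
      subst h h'
      rw [phi_cast' _ (by omega) (by omega), phi_cast' _ (by omega) (by omega)]
      omega
  unfold mixedGrid at h
  rw [SimpleGraph.fromRel_adj] at h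
  rcases h.2 with h | h
  · exact Or.inl (key _ _ h)
  · exact Or.inr (key _ _ h)

lemma adj_of_rel (k n : ℕ) [NeZero (4 * n * k)] (Ih Ic : Finset ℕ)
    (u v : Fin k × ZMod (4 * n * k)) (hne : u ≠ v)
    (h : Rel k (4 * n * k) Ih Ic (co u) (co v) ∨ Rel k (4 * n * k) Ih Ic (co v) (co u)) :
    (mixedGrid k n Ih Ic).Adj u v := by
  have key : ∀ p q : Fin k × ZMod (4 * n * k),
      Rel k (4 * n * k) Ih Ic (co p) (co q) →
    ((p.1 = q.1 ∧ q.2 = p.2 + 1) ∨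
    (p.2 = q.2 ∧ (q.1 : ℕ) = (p.1 : ℕ) + 1) ∨
    ((p.1 : ℕ) = 0 ∧ (q.1 : ℕ) = 0 ∧ ∃ i ∈ Ih, ∃ j ∈ Finset.Icc 1 k,
      ((p.2 = ((4 * k * (i - 1) + j : ℕ) : ZMod (4 * n * k)) ∧
        q.2 = ((4 * k * (i - 1) + 3 * k - j + 1 : ℕ) : ZMod (4 * n * k))) ∨
       (p.2 = ((4 * k * (i - 1) + k + j : ℕ) : ZMod (4 * n * k)) ∧
        q.2 = ((4 * k * (i - 1) + 4 * k - j + 1 : ℕ) : ZMod (4 * n * k))))) ∨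
    ((p.1 : ℕ) = 0 ∧ (q.1 : ℕ) = 0 ∧ ∃ i ∈ Ic, ∃ j ∈ Finset.Icc 1 (2 * k),
      p.2 = ((4 * k * (i - 1) + j : ℕ) : ZMod (4 * n * k)) ∧
      q.2 = ((4 * k * (i - 1) + 2 * k + j : ℕ) : ZMod (4 * n * k)))) := by
    rintro ⟨p1, p2⟩ ⟨q1, q2⟩ h
    have ep := cast_phi p2
    have eq := cast_phi q2
    simp only [co, Rel] at h ⊢
    generalize phi p2 = x at *
    generalize phi q2 = y at *
    subst ep eq
    rcases h with ⟨h1, rfl⟩ | ⟨h1, h, rfl⟩ | ⟨rfl, h⟩ | ⟨h1, h2, i, hi, j, hj, h⟩ |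
      ⟨h1, h2, i, hi, j, hj, h, h'⟩
    · left; exact ⟨Fin.ext h1, by push_cast; rfl⟩
    · left; refine ⟨Fin.ext h1, ?_⟩
      rw [h]; simp
    · right; left; exact ⟨rfl, h⟩
    · right; right; left
      refine ⟨h1, h2, i, hi, j + 1, Finset.mem_Icc.2 ⟨by omega, by omega⟩, ?_⟩
      rcases h with ⟨h, h'⟩ | ⟨h, h'⟩
      · left; constructor <;> congr 1 <;> omega
      · right; constructor <;> congr 1 <;> omega
    · right; right; right
      refine ⟨h1, h2, i, hi, j + 1, Finset.mem_Icc.2 ⟨by omega, by omega⟩, ?_⟩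
      constructor <;> congr 1 <;> omega
  unfold mixedGrid
  rw [SimpleGraph.fromRel_adj]
  exact ⟨hne, h.imp (key _ _) (key _ _)⟩

lemma co_inj {k N : ℕ} [NeZero N] {u v : Fin k × ZMod N} (h : co u = co v) : u = v := by
  obtain ⟨u1, u2⟩ := u
  obtain ⟨v1, v2⟩ := v
  simp only [co, Prod.mk.injEq] at h
  ext1
  · exact Fin.ext h.1
  · rw [← cast_phi u2, ← cast_phi v2, h.2]

lemma co_surj {k N : ℕ} {ρ y : ℕ} (h1 : ρ < k) (h2 : y < N) :
    ∃ u : Fin k × ZMod N, co u = (ρ, y) :=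
  ⟨(⟨ρ, h1⟩, ((y + 1 : ℕ) : ZMod N)), by simp only [co]; rw [phi_cast y h2]⟩

/-- Connection inside `Y` along `R`-edges. -/
def Conn (R : ℕ × ℕ → ℕ × ℕ → Prop) (Y : ℕ × ℕ → Prop) : ℕ × ℕ → ℕ × ℕ → Prop :=
  Relation.ReflTransGen (fun p q => Y p ∧ Y q ∧ (R p q ∨ R q p))

lemma Conn.symm {R : ℕ × ℕ → ℕ × ℕ → Prop} {Y : ℕ × ℕ → Prop} {p q : ℕ × ℕ}
    (h : Conn R Y p q) : Conn R Y q p := by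
  induction h with
  | refl => exact Relation.ReflTransGen.refl
  | tail _ h2 ih => exact Relation.ReflTransGen.head ⟨h2.2.1, h2.1, h2.2.2.symm⟩ ih

lemma Conn.trans {R : ℕ × ℕ → ℕ × ℕ → Prop} {Y : ℕ × ℕ → Prop} {p q r : ℕ × ℕ}
    (h : Conn R Y p q) (h' : Conn R Y q r) : Conn R Y p r :=
  Relation.ReflTransGen.trans h h'

lemma Conn.step {R : ℕ × ℕ → ℕ × ℕ → Prop} {Y : ℕ × ℕ → Prop} {p q : ℕ × ℕ}
    (h1 : Y p) (h2 : Y q) (h : R p q) : Conn R Y p q :=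
  Relation.ReflTransGen.single ⟨h1, h2, Or.inl h⟩

lemma hseg {k M : ℕ} {Ih Ic : Finset ℕ} {Y : ℕ × ℕ → Prop} (ρ x0 x1 : ℕ) (h : x0 ≤ x1)
    (hY : ∀ x, x0 ≤ x → x ≤ x1 → Y (ρ, x)) : Conn (Rel k M Ih Ic) Y (ρ, x0) (ρ, x1) := by
  induction x1, h using Nat.le_induction with
  | base => exact Relation.ReflTransGen.refl
  | succ x hx ih =>
    refine (ih fun z h1 h2 => hY z h1 (by omega)).trans
      (Conn.step (hY _ hx (by omega)) (hY _ (by omega) (by omega)) ?_)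
    exact Or.inl ⟨rfl, rfl⟩

lemma vseg {k M : ℕ} {Ih Ic : Finset ℕ} {Y : ℕ × ℕ → Prop} (y x0 x1 : ℕ) (h : x0 ≤ x1)
    (hY : ∀ x, x0 ≤ x → x ≤ x1 → Y (x, y)) : Conn (Rel k M Ih Ic) Y (x0, y) (x1, y) := by
  induction x1, h using Nat.le_induction with
  | base => exact Relation.ReflTransGen.refl
  | succ x hx ih =>
    refine (ih fun z h1 h2 => hY z h1 (by omega)).trans
      (Conn.step (hY _ hx (by omega)) (hY _ (by omega) (by omega)) ?_)
    exact Or.inr (Or.inr (Or.inl ⟨rfl, rfl⟩))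

/-- A nested cup hanging from row `0` at columns `L` and `R`, of depth `s`. -/
def Cup (L R s : ℕ) (p : ℕ × ℕ) : Prop :=
  ((p.2 = L ∨ p.2 = R) ∧ p.1 ≤ s) ∨ (p.1 = s ∧ L ≤ p.2 ∧ p.2 ≤ R)

lemma cup_conn {k M : ℕ} {Ih Ic : Finset ℕ} {Y : ℕ × ℕ → Prop} (L R s : ℕ) (hLR : L ≤ R)
    (hY : ∀ p, Cup L R s p → Y p) (p : ℕ × ℕ) (hp : Cup L R s p) :
    Conn (Rel k M Ih Ic) Y (0, L) p := by
  have hv : ∀ ρ, ρ ≤ s → Conn (Rel k M Ih Ic) Y (0, L) (ρ, L) := fun ρ h =>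
    vseg L 0 ρ (by omega) fun x _ h2 => hY _ (Or.inl ⟨Or.inl rfl, by simp only; omega⟩)
  have hh : ∀ y, L ≤ y → y ≤ R → Conn (Rel k M Ih Ic) Y (0, L) (s, y) := fun y h h' =>
    (hv s le_rfl).trans
      (hseg s L y h fun x h1 h2 => hY _ (Or.inr ⟨rfl, h1, by simp only; omega⟩))
  obtain ⟨ρ, y⟩ := p
  rcases hp with ⟨h | h, h'⟩ | ⟨h, h1, h2⟩
  · simp only at h h'; subst h; exact hv ρ h'
  · simp only at h h'; subst h
    exact (hh y hLR le_rfl).trans (Conn.symm (vseg y ρ s h'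
      fun x _ h2 => hY _ (Or.inl ⟨Or.inr rfl, h2⟩)))
  · simp only at h h1 h2; subst h; exact hh y h1 h2

/-- First big column of the group of small column `c`. -/
def bs (k s c : ℕ) : ℕ :=
  if c < s then 9 * c else if c < s + 6 * k then 8 * s + c
  else if c < s + 8 * k then 8 * s + c + 16 * k else 9 * c

/-- Anchor column of small column `c`. -/
def an (k s c : ℕ) : ℕ :=
  if c < s then 9 * c + 4 else if c < s + 6 * k then 8 * s + c
  else if c < s + 8 * k then 8 * s + c + 16 * k else 9 * c + 4

/-- Where the strand with index `t` enters the handle. -/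
def fe (k t : ℕ) : ℕ :=
  if t < k then t else if t < 2 * k then t + 8 * k else if t < 3 * k then t + 24 * k
  else t + 32 * k

lemma bs_lt (k s c : ℕ) : bs k s c < bs k s (c + 1) := by unfold bs; split_ifs <;> omega

lemma bs_mono (k s : ℕ) : StrictMono (bs k s) := strictMono_nat_of_lt_succ (bs_lt k s)

lemma bs_le_an (k s c : ℕ) : bs k s c ≤ an k s c := by unfold bs an; split_ifs <;> omega

lemma an_lt_bs (k s c : ℕ) : an k s c < bs k s (c + 1) := by
  unfold bs an; split_ifs <;> omega

lemma grp_inj {k s c c' y : ℕ} (h1 : bs k s c ≤ y) (h2 : y < bs k s (c + 1))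
    (h3 : bs k s c' ≤ y) (h4 : y < bs k s (c' + 1)) : c = c' := by
  have a1 := (bs_mono k s).lt_iff_lt.1 (lt_of_le_of_lt h1 h4)
  have a2 := (bs_mono k s).lt_iff_lt.1 (lt_of_le_of_lt h3 h2)
  omega

lemma an_out (k s c : ℕ) : (an k s c < 9 * s + 14 * k) ∨
    (9 * s + 22 * k ≤ an k s c ∧ an k s c < 9 * s + 32 * k) ∨ 9 * s + 72 * k ≤ an k s c := by
  unfold an; split_ifs <;> omega

lemma fe_mono {k t t' : ℕ} (h : t < t') : fe k t < fe k t' := by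
  unfold fe; split_ifs <;> omega

lemma fe_bd {k t : ℕ} (h : t < 4 * k) : t ≤ fe k t ∧ fe k t < 36 * k := by
  unfold fe; split_ifs <;> omega

/-- Extra part of the branch sets of the handle columns. -/
def Ext (k s t : ℕ) (p : ℕ × ℕ) : Prop :=
  Cup (9 * s + 18 * k - 1 - t) (9 * s + 18 * k + t) t p ∨
  Cup (9 * s + 36 * k - 1 - t) (9 * s + 36 * k + fe k t) t p

/-- The branch sets. -/
def Br (k s r c : ℕ) (p : ℕ × ℕ) : Prop :=
  (p.1 = 8 * k + r ∧ bs k s c ≤ p.2 ∧ p.2 < bs k s (c + 1)) ∨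
  (r = 0 ∧ p.1 < 8 * k ∧ p.2 = an k s c) ∨
  (r = 0 ∧ ∃ t < 4 * k, c = s + t ∧ Ext k s t p)

lemma ext_bd {k s t : ℕ} {p : ℕ × ℕ} (ht : t < 4 * k) (h : Ext k s t p) :
    p.1 < 4 * k ∧ ((9 * s + 14 * k ≤ p.2 ∧ p.2 < 9 * s + 22 * k) ∨
      (9 * s + 32 * k ≤ p.2 ∧ p.2 < 9 * s + 72 * k)) := by
  have := fe_bd ht
  unfold Ext Cup at h
  omega

lemma ext_inj_aux {k s t t' : ℕ} {p : ℕ × ℕ} (ht : t < 4 * k) (ht' : t' < 4 * k)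
    (hlt : t < t') (h : Ext k s t p) (h' : Ext k s t' p) : False := by
  have := fe_bd ht
  have := fe_bd ht'
  have := fe_mono (k := k) hlt
  unfold Ext Cup at h h'
  omega

lemma ext_inj {k s t t' : ℕ} {p : ℕ × ℕ} (ht : t < 4 * k) (ht' : t' < 4 * k)
    (h : Ext k s t p) (h' : Ext k s t' p) : t = t' := by
  rcases Nat.lt_trichotomy t t' with h1 | h1 | h1
  · exact (ext_inj_aux ht ht' h1 h h').elim
  · exact h1
  · exact (ext_inj_aux ht' ht h1 h' h).elim

lemma br_inj {k s r c r' c' : ℕ} {p : ℕ × ℕ}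
    (h : Br k s r c p) (h' : Br k s r' c' p) : r = r' ∧ c = c' := by
  rcases h with ⟨h1, h2, h3⟩ | ⟨h1, h2, h3⟩ | ⟨h1, t, ht, h2, h3⟩ <;>
  rcases h' with ⟨g1, g2, g3⟩ | ⟨g1, g2, g3⟩ | ⟨g1, t', ht', g2, g3⟩
  · exact ⟨by omega, grp_inj h2 h3 g2 g3⟩
  · omega
  · have := ext_bd ht' g3; omega
  · omega
  · refine ⟨by omega, grp_inj (bs_le_an k s c) (an_lt_bs k s c) ?_ ?_⟩
    · rw [← h3, g3]; exact bs_le_an k s c'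
    · rw [← h3, g3]; exact an_lt_bs k s c'
  · have := ext_bd ht' g3
    have := an_out k s c
    omega
  · have := ext_bd ht h3; omega
  · have := ext_bd ht h3
    have := an_out k s c'
    omega
  · have := ext_inj ht ht' h3 g3
    omega

lemma bs_end {k s M : ℕ} (h : s + 8 * k ≤ M) : bs k s M = 9 * M := by
  unfold bs; split_ifs <;> omega

lemma br_range {k s M r c : ℕ} {p : ℕ × ℕ} (hM : s + 8 * k ≤ M)
    (hr : r < k) (hc : c < M) (h : Br k s r c p) : p.1 < 9 * k ∧ p.2 < 9 * M := by
  have h0 := bs_end hM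
  have h5 : bs k s (c + 1) ≤ bs k s M := (bs_mono k s).monotone hc
  have := an_lt_bs k s c
  rcases h with ⟨h1, h2, h3⟩ | ⟨h1, h2, h3⟩ | ⟨h1, t, ht, h2, h3⟩
  · omega
  · omega
  · have := ext_bd ht h3; omega

lemma an_spec (k s t : ℕ) (ht : t < 6 * k) : an k s (s + t) = 9 * s + t := by
  unfold an; split_ifs <;> omega

lemma an_spec' (k s t : ℕ) (h6 : 6 * k ≤ t) (ht : t < 8 * k) :
    an k s (s + t) = 9 * s + t + 16 * k := by
  unfold an; split_ifs <;> omega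

lemma an_out_spec (k s c : ℕ) (h : c < s ∨ s + 8 * k ≤ c) : an k s c = 9 * c + 4 := by
  unfold an; split_ifs <;> omega

lemma br_top (k s c : ℕ) (hk : 1 ≤ k) : Br k s 0 c (0, an k s c) :=
  Or.inr (Or.inl ⟨rfl, by simp only; omega, rfl⟩)

lemma br_root (k s r c : ℕ) : Br k s r c (8 * k + r, bs k s c) :=
  Or.inl ⟨rfl, le_rfl, bs_lt k s c⟩

lemma br_conn {k s r c M i : ℕ} {Ih Ic : Finset ℕ} (hk : 1 ≤ k) (hi : i ∈ Ic)
    (hs : s = 4 * k * (i - 1)) (p : ℕ × ℕ) (hp : Br k s r c p) :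
    Conn (Rel (9 * k) M Ih Ic) (Br k s r c) (8 * k + r, bs k s c) p := by
  have hS : 4 * (9 * k) * (i - 1) = 9 * s := by rw [hs]; ring
  have hrow : ∀ y, bs k s c ≤ y → y < bs k s (c + 1) →
      Conn (Rel (9 * k) M Ih Ic) (Br k s r c) (8 * k + r, bs k s c) (8 * k + r, y) :=
    fun y h1 h2 => hseg _ _ _ h1 fun x h3 h4 => Or.inl ⟨rfl, h3, by simp only; omega⟩
  have hcol : r = 0 → ∀ ρ < 8 * k,
      Conn (Rel (9 * k) M Ih Ic) (Br k s r c) (8 * k + r, bs k s c) (ρ, an k s c) := by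
    intro hr ρ hρ
    refine (hrow _ (bs_le_an k s c) (an_lt_bs k s c)).trans (Conn.symm ?_)
    refine vseg _ _ _ (by omega) fun x h1 h2 => ?_
    rcases Nat.lt_or_ge x (8 * k) with h | h
    · exact Or.inr (Or.inl ⟨hr, h, rfl⟩)
    · exact Or.inl ⟨by simp only; omega, bs_le_an k s c, an_lt_bs k s c⟩
  rcases hp with ⟨h1, h2, h3⟩ | ⟨h1, h2, h3⟩ | ⟨h1, t, ht, h2, h3⟩
  · obtain ⟨ρ, y⟩ := p
    simp only at h1 h2 h3
    subst h1
    exact hrow y h2 h3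
  · obtain ⟨ρ, y⟩ := p
    simp only at h2 h3
    subst h3
    exact hcol h1 ρ h2
  · have hfe := fe_bd ht
    have han : an k s c = 9 * s + t := by rw [h2]; exact an_spec k s t (by omega)
    have hY : ∀ p, Ext k s t p → Br k s r c p := fun p hp => Or.inr (Or.inr ⟨h1, t, ht, h2, hp⟩)
    have c1 := fun p hp => cup_conn (k := 9 * k) (M := M) (Ih := Ih) (Ic := Ic)
      (Y := Br k s r c) (9 * s + 18 * k - 1 - t) (9 * s + 18 * k + t) t (by omega)
      (fun p hp => hY p (Or.inl hp)) p hp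
    have c2 := fun p hp => cup_conn (k := 9 * k) (M := M) (Ih := Ih) (Ic := Ic)
      (Y := Br k s r c) (9 * s + 36 * k - 1 - t) (9 * s + 36 * k + fe k t) t (by omega)
      (fun p hp => hY p (Or.inr hp)) p hp
    have e1 : Cup (9 * s + 18 * k - 1 - t) (9 * s + 18 * k + t) t (0, 9 * s + 18 * k + t) :=
      Or.inl ⟨Or.inr rfl, Nat.zero_le _⟩
    have e1' : Cup (9 * s + 18 * k - 1 - t) (9 * s + 18 * k + t) t (0, 9 * s + 18 * k - 1 - t) :=
      Or.inl ⟨Or.inl rfl, Nat.zero_le _⟩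
    have e2 : Cup (9 * s + 36 * k - 1 - t) (9 * s + 36 * k + fe k t) t
        (0, 9 * s + 36 * k - 1 - t) := Or.inl ⟨Or.inl rfl, Nat.zero_le _⟩
    have d1 : Conn (Rel (9 * k) M Ih Ic) (Br k s r c) (0, an k s c) (0, 9 * s + 18 * k + t) := by
      refine Conn.step (Or.inr (Or.inl ⟨h1, by simp only; omega, rfl⟩)) (hY _ (Or.inl e1)) ?_
      refine Or.inr (Or.inr (Or.inr (Or.inr ⟨rfl, rfl, i, hi, t, by omega, ?_, ?_⟩))) <;>
        simp only [hS] <;> omega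
    have d2 : Conn (Rel (9 * k) M Ih Ic) (Br k s r c) (0, 9 * s + 18 * k - 1 - t)
        (0, 9 * s + 36 * k - 1 - t) := by
      refine Conn.step (hY _ (Or.inl e1')) (hY _ (Or.inr e2)) ?_
      refine Or.inr (Or.inr (Or.inr (Or.inr ⟨rfl, rfl, i, hi, 18 * k - 1 - t, by omega, ?_, ?_⟩)))
        <;> simp only [hS] <;> omega
    have z1 := ((hcol h1 0 (by omega)).trans d1).trans (c1 _ e1).symm
    rcases h3 with h3 | h3
    · exact z1.trans (c1 p h3)
    · exact (z1.trans d2).trans (c2 p h3)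

lemma br_fe {k s t : ℕ} (ht : t < 4 * k) :
    Br k s 0 (s + t) (0, 9 * s + 36 * k + fe k t) :=
  Or.inr (Or.inr ⟨rfl, t, ht, rfl, Or.inr (Or.inl ⟨Or.inr rfl, Nat.zero_le _⟩)⟩)

lemma block_sep (k i i' : ℕ) (h1 : 1 ≤ i) (h1' : 1 ≤ i') (hne : i' ≠ i) (hne' : i' ≠ i + 1) :
    4 * k * (i' - 1) + 4 * k ≤ 4 * k * (i - 1) ∨
      4 * k * (i - 1) + 8 * k ≤ 4 * k * (i' - 1) := by
  rcases Nat.lt_or_ge i' i with h | h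
  · left
    have := Nat.mul_le_mul_left (4 * k) (show i' - 1 + 1 ≤ i - 1 by omega)
    linarith
  · right
    have := Nat.mul_le_mul_left (4 * k) (show i - 1 + 2 ≤ i' - 1 by omega)
    linarith

lemma br_edge {k s M i : ℕ} {Ih Ic : Finset ℕ} (hk : 1 ≤ k) (hi : i ∈ Ic) (hi' : i + 1 ∈ Ih)
    (hd : Disjoint Ih Ic) (hp : ∀ j, j ∈ Ih ∨ j ∈ Ic → 2 ≤ j)
    (hs : s = 4 * k * (i - 1)) (hM : s + 8 * k ≤ M) (p q : ℕ × ℕ)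
    (h : Rel k M (insert i (Ih.erase (i + 1))) (insert (i + 1) (Ic.erase i)) p q) :
    ∃ a b, Br k s p.1 p.2 a ∧ Br k s q.1 q.2 b ∧ Rel (9 * k) (9 * M) Ih Ic a b := by
  obtain ⟨r, c⟩ := p
  obtain ⟨r', c'⟩ := q
  have hS : ∀ j, 4 * (9 * k) * (j - 1) = 9 * (4 * k * (j - 1)) := fun j => by ring
  have hi2 := hp i (Or.inr hi)
  have hs1 : 4 * k * (i + 1 - 1) = s + 4 * k := by
    obtain ⟨z, rfl⟩ : ∃ z, i = z + 1 := ⟨i - 1, by omega⟩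
    rw [hs]; simp only [Nat.add_sub_cancel]; ring
  simp only [Rel] at h
  rcases h with ⟨rfl, rfl⟩ | ⟨rfl, h, rfl⟩ | ⟨rfl, rfl⟩ | ⟨rfl, rfl, j, hj, t, ht, h⟩ |
    ⟨rfl, rfl, j, hj, t, ht, h⟩
  · have := bs_lt k s c
    refine ⟨(8 * k + r, bs k s (c + 1) - 1), (8 * k + r, bs k s (c + 1)),
      Or.inl ⟨rfl, by simp only; omega, by simp only; omega⟩, br_root _ _ _ _,
      Or.inl ⟨rfl, by simp only; omega⟩⟩
  · have h1 := bs_lt k s c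
    have h2 := bs_end hM
    rw [h] at h1
    refine ⟨(8 * k + r, 9 * M - 1), (8 * k + r, bs k s 0),
      Or.inl ⟨rfl, by simp only; omega, by simp only [h]; omega⟩, br_root _ _ _ _,
      Or.inr (Or.inl ⟨rfl, by simp only; omega, ?_⟩)⟩
    simp only [bs]; split_ifs <;> omega
  · exact ⟨(8 * k + r, bs k s c), (8 * k + (r + 1), bs k s c), br_root _ _ _ _, br_root _ _ _ _,
      Or.inr (Or.inr (Or.inl ⟨rfl, by simp only; omega⟩))⟩
  · rw [Finset.mem_insert, Finset.mem_erase] at hj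
    rcases hj with rfl | ⟨hj1, hj⟩
    · rw [← hs] at h
      have hc : ∃ u, u < 4 * k ∧ c = s + u := ⟨c - s, by omega, by omega⟩
      have hc' : ∃ u, u < 4 * k ∧ c' = s + u := ⟨c' - s, by omega, by omega⟩
      obtain ⟨u, hu, rfl⟩ := hc
      obtain ⟨u', hu', rfl⟩ := hc'
      refine ⟨_, _, br_fe hu, br_fe hu', Or.inr (Or.inr (Or.inr (Or.inl
        ⟨rfl, rfl, j + 1, hi', t, by omega, ?_⟩)))⟩
      simp only [hS, hs1]
      rcases h with ⟨h, h'⟩ | ⟨h, h'⟩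
      · left; unfold fe; split_ifs <;> omega
      · right; unfold fe; split_ifs <;> omega
    · have hne : j ≠ i := by
        rintro rfl
        exact Finset.disjoint_left.1 hd hj hi
      have hsep := block_sep k i j (by omega) (by have := hp j (Or.inl hj); omega) hne hj1
      rw [← hs] at hsep
      refine ⟨_, _, br_top k s c hk, br_top k s c' hk, Or.inr (Or.inr (Or.inr (Or.inl
        ⟨rfl, rfl, j, hj, 9 * t + 4, by omega, ?_⟩)))⟩
      rw [an_out_spec k s c (by omega), an_out_spec k s c' (by omega)]
      simp only [hS]
      omega
  · rw [Finset.mem_insert, Finset.mem_erase] at hj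
    rcases hj with rfl | ⟨hj1, hj⟩
    · rw [hs1] at h
      refine ⟨_, _, br_top k s c hk, br_top k s c' hk, Or.inr (Or.inr (Or.inr (Or.inr
        ⟨rfl, rfl, i, hi, 4 * k + t, by omega, ?_⟩)))⟩
      have e1 : c = s + (4 * k + t) := by omega
      have e2 : c' = s + (6 * k + t) := by omega
      rw [e1, e2, an_spec k s _ (by omega), an_spec' k s _ (by omega) (by omega)]
      simp only [hS, ← hs, true_and]
      omega
    · have hne : j ≠ i + 1 := by
        rintro rfl
        exact Finset.disjoint_left.1 hd hi' hj
      have hsep := block_sep k i j (by omega) (by have := hp j (Or.inr hj); omega) hj1 hne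
      rw [← hs] at hsep
      refine ⟨_, _, br_top k s c hk, br_top k s c' hk, Or.inr (Or.inr (Or.inr (Or.inr
        ⟨rfl, rfl, j, hj, 9 * t + 4, by omega, ?_⟩)))⟩
      rw [an_out_spec k s c (by omega), an_out_spec k s c' (by omega)]
      simp only [hS]
      omega

end SwapAux

/-- Let `k, h, c ≥ 1` and let `{I'_hdl, I'_crscp}` be a partition of
`[2, h+c+1]` with `|I'_hdl| = h` and `|I'_crscp| = c`.  Suppose `i ∈ I'_crscp` and
`i+1 ∈ I'_hdl`, and set `I_hdl := (I'_hdl \ {i+1}) ∪ {i}` and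
`I_crscp := (I'_crscp \ {i}) ∪ {i+1}`.  Then the mixed surface grid of order `9k` with
handle/crosscap positions `I'_hdl, I'_crscp` contains the mixed surface grid of order `k`
with handle/crosscap positions `I_hdl, I_crscp` as a minor. -/
theorem mixedGrid_swap_crosscap_handle (k h c : ℕ) (hk : 1 ≤ k) (hh : 1 ≤ h) (hc : 1 ≤ c)
    (I'h I'c : Finset ℕ)
    (hpart : I'h ∪ I'c = Finset.Icc 2 (h + c + 1)) (hdisj : Disjoint I'h I'c)
    (hIh : I'h.card = h) (hIc : I'c.card = c)
    (i : ℕ) (hi : i ∈ I'c) (hi1 : i + 1 ∈ I'h) :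
    IsMinorOf
      (mixedGrid k (h + c + 1) (insert i (I'h.erase (i + 1))) (insert (i + 1) (I'c.erase i)))
      (mixedGrid (9 * k) (h + c + 1) I'h I'c) := by
  have hn : 0 < h + c + 1 := by omega
  have : NeZero (4 * (h + c + 1) * k) := ⟨by positivity⟩
  have : NeZero (4 * (h + c + 1) * (9 * k)) := ⟨by positivity⟩
  have hN : 4 * (h + c + 1) * (9 * k) = 9 * (4 * (h + c + 1) * k) := by ring
  have hrange : ∀ j, j ∈ I'h ∨ j ∈ I'c → 2 ≤ j ∧ j ≤ h + c + 1 := fun j hj =>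
    Finset.mem_Icc.1 (hpart ▸ Finset.mem_union.2 hj)
  obtain ⟨s, hs⟩ : ∃ s, s = 4 * k * (i - 1) := ⟨_, rfl⟩
  have hM : s + 8 * k ≤ 4 * (h + c + 1) * k := by
    have h1 := SwapAux.block_le k (h + c + 1) (i + 1) (hrange _ (Or.inl hi1)).1
      (hrange _ (Or.inl hi1)).2
    have h2 := (hrange i (Or.inr hi)).1
    have h3 : 4 * k * (i + 1 - 1) = s + 4 * k := by
      obtain ⟨z, rfl⟩ : ∃ z, i = z + 1 := ⟨i - 1, by omega⟩
      rw [hs]; simp only [Nat.add_sub_cancel]; ring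
    omega
  -- every coordinate pair of a branch set is the coordinate pair of a vertex
  have hsurj : ∀ (u : Fin k × ZMod (4 * (h + c + 1) * k)) (p : ℕ × ℕ),
      SwapAux.Br k s (SwapAux.co u).1 (SwapAux.co u).2 p →
      ∃ x : Fin (9 * k) × ZMod (4 * (h + c + 1) * (9 * k)), SwapAux.co x = p := by
    intro u p hp
    have := SwapAux.br_range hM u.1.isLt (SwapAux.phi_lt u.2) hp
    exact SwapAux.co_surj this.1 (by rw [hN]; exact this.2)
  have hdis : ∀ u v : Fin k × ZMod (4 * (h + c + 1) * k), u ≠ v → ∀ p,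
      SwapAux.Br k s (SwapAux.co u).1 (SwapAux.co u).2 p →
      SwapAux.Br k s (SwapAux.co v).1 (SwapAux.co v).2 p → False := by
    intro u v huv p h1 h2
    have := SwapAux.br_inj h1 h2
    exact huv (SwapAux.co_inj (Prod.ext this.1 this.2))
  refine ⟨fun u => {x | SwapAux.Br k s (SwapAux.co u).1 (SwapAux.co u).2 (SwapAux.co x)},
    ?_, ?_, ?_⟩
  · intro u v huv
    rw [Set.disjoint_left]
    intro x hx hx'
    exact hdis u v huv _ hx hx'
  · intro u
    rw [SimpleGraph.connected_iff_exists_forall_reachable]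
    obtain ⟨x0, hx0⟩ := hsurj u _ (SwapAux.br_root k s _ _)
    refine ⟨⟨x0, by rw [Set.mem_ofPred_eq, hx0]; exact SwapAux.br_root k s _ _⟩, ?_⟩
    rintro ⟨x, hx⟩
    have hconn := SwapAux.br_conn (M := 4 * (h + c + 1) * (9 * k)) (Ih := I'h) hk hi hs _ hx
    generalize hp : SwapAux.co x = p at hconn
    induction hconn generalizing x with
    | refl =>
      have : x0 = x := SwapAux.co_inj (hx0.trans hp.symm)
      subst this
      exact SimpleGraph.Reachable.refl _
    | tail _ hstep ih =>
      obtain ⟨y, hy⟩ := hsurj u _ hstep.1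
      refine (ih y (by rw [Set.mem_ofPred_eq, hy]; exact hstep.1) hy).trans ?_
      by_cases hxy : y = x
      · subst hxy; exact SimpleGraph.Reachable.refl _
      · refine SimpleGraph.Adj.reachable ?_
        rw [SimpleGraph.comap_adj]
        refine SwapAux.adj_of_rel _ _ _ _ y x hxy ?_
        rw [hy, hp]
        exact hstep.2.2
  · intro u v huv
    have key : ∀ u v : Fin k × ZMod (4 * (h + c + 1) * k), u ≠ v →
        SwapAux.Rel k (4 * (h + c + 1) * k) (insert i (I'h.erase (i + 1)))
          (insert (i + 1) (I'c.erase i)) (SwapAux.co u) (SwapAux.co v) →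
        ∃ a b, SwapAux.Br k s (SwapAux.co u).1 (SwapAux.co u).2 (SwapAux.co a) ∧
          SwapAux.Br k s (SwapAux.co v).1 (SwapAux.co v).2 (SwapAux.co b) ∧
          (mixedGrid (9 * k) (h + c + 1) I'h I'c).Adj a b := by
      intro u v hne hr
      obtain ⟨p, q, hp, hq, hpq⟩ := SwapAux.br_edge hk hi hi1 hdisj
        (fun j hj => (hrange j hj).1) hs hM _ _ hr
      rw [← hN] at hpq
      obtain ⟨a, rfl⟩ := hsurj u p hp
      obtain ⟨b, rfl⟩ := hsurj v q hq
      refine ⟨a, b, hp, hq, SwapAux.adj_of_rel _ _ _ _ a b ?_ (Or.inl ?_)⟩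
      · rintro rfl
        exact hdis u v hne _ hp hq
      · exact hpq
    have hr := SwapAux.rel_of_adj _ _ _ _ ?_ ?_ u v huv
    · rcases hr with hr | hr
      · obtain ⟨a, b, ha, hb, hab⟩ := key u v huv.ne hr
        exact ⟨a, ha, b, hb, hab⟩
      · obtain ⟨a, b, ha, hb, hab⟩ := key v u huv.ne.symm hr
        exact ⟨b, hb, a, ha, hab.symm⟩
    · intro j hj
      rcases Finset.mem_insert.1 hj with rfl | hj
      · exact hrange _ (Or.inr hi)
      · exact hrange j (Or.inl (Finset.mem_of_mem_erase hj))
    · intro j hj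
      rcases Finset.mem_insert.1 hj with rfl | hj
      · exact hrange _ (Or.inl hi1)
      · exact hrange j (Or.inr (Finset.mem_of_mem_erase hj))
end

section
/- Let k, h, c ≥ 1 be integers and let {I'_hdl, I'_crscp} be a partition of [2, h+c+1] with |I'_hdl| = h and |I'_crscp| = c. Suppose j ∈ I'_hdl and j+1 ∈ I'_crscp, and set J_hdl := (I'_hdl \ {j}) ∪ {j+1} and J_crscp := (I'_crscp \ {j+1}) ∪ {j}. Then the mixed surface grid H^{9k}_{I'_hdl,I'_crscp} of order 9k with h handles and c crosscaps contains the mixed surface grid H^k_{J_hdl,J_crscp} of order k with h handles and c crosscaps as a minor. -/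
open SimpleGraph

/-- Zero-based column of a vertex. -/
def colOf {k N : ℕ} (v : Fin k × ZMod N) : ℕ := (v.2 - 1).val

/-- The vertex in row `r` and zero-based column `c`. -/
def vtx {k : ℕ} (N : ℕ) (r c : ℕ) (hr : r < k) : Fin k × ZMod N := (⟨r, hr⟩, ((c + 1 : ℕ) : ZMod N))

lemma colOf_vtx {k N r c : ℕ} (hr : r < k) (hc : c < N) : colOf (vtx N r c hr) = c := by
  simp only [colOf, vtx]
  push_cast
  rw [add_sub_cancel_right]
  exact ZMod.val_cast_of_lt hc

lemma vtx_fst {k N r c : ℕ} (hr : r < k) : ((vtx N r c hr).1 : ℕ) = r := rfl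

lemma colOf_lt {k N : ℕ} (hN : 0 < N) (v : Fin k × ZMod N) : colOf v < N := by
  have : NeZero N := ⟨hN.ne'⟩
  exact ZMod.val_lt _

lemma eq_vtx {k N : ℕ} (hN : 0 < N) (v : Fin k × ZMod N) :
    v = vtx N v.1 (colOf v) v.1.2 := by
  have : NeZero N := ⟨hN.ne'⟩
  refine Prod.ext rfl ?_
  simp only [vtx, colOf]
  push_cast
  rw [ZMod.natCast_zmod_val]
  ring

lemma colOf_of_eq {k N m : ℕ} (v : Fin k × ZMod N) (h : v.2 = (m : ZMod N)) (h1 : 1 ≤ m)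
    (h2 : m ≤ N) : colOf v = m - 1 := by
  obtain ⟨m, rfl⟩ : ∃ a, m = a + 1 := ⟨m - 1, by omega⟩
  simp only [colOf, h]
  push_cast
  rw [add_sub_cancel_right]
  exact ZMod.val_cast_of_lt (by omega)

lemma colOf_succ {k N : ℕ} (hN : 0 < N) (v w : Fin k × ZMod N) (h : w.2 = v.2 + 1) :
    (colOf v + 1 < N ∧ colOf w = colOf v + 1) ∨ (colOf v + 1 = N ∧ colOf w = 0) := by
  have hv := colOf_lt hN v
  have e := congrArg Prod.snd (eq_vtx hN v)
  simp only [vtx] at e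
  rw [e] at h
  by_cases h1 : colOf v + 1 < N
  · left
    refine ⟨h1, ?_⟩
    have := colOf_of_eq (m := colOf v + 1 + 1) w (by rw [h]; push_cast; ring) (by omega) (by omega)
    omega
  · right
    refine ⟨by omega, ?_⟩
    have h2 : colOf v + 1 = N := by omega
    rw [h2] at h
    have := colOf_of_eq (m := 1) w (by rw [h]; simp) (by omega) (by omega)
    omega

lemma vtx_ne_of_col {k N r r' c c' : ℕ} (hr : r < k) (hr' : r' < k) (hc : c < N) (hc' : c' < N)
    (h : c ≠ c') : vtx N r c hr ≠ vtx N r' c' hr' := by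
  intro e
  have := congrArg colOf e
  rw [colOf_vtx hr hc, colOf_vtx hr' hc'] at this
  exact h this

section adj
variable {k n : ℕ} {Ih Ic : Finset ℕ}

lemma adj_right {r c : ℕ} (hr : r < k) (hc : c + 1 < 4 * n * k) :
    (mixedGrid k n Ih Ic).Adj (vtx _ r c hr) (vtx _ r (c + 1) hr) := by
  refine ⟨vtx_ne_of_col hr hr (by omega) hc (by omega), Or.inl (Or.inl ⟨rfl, ?_⟩)⟩
  simp only [vtx]; push_cast; ring

lemma adj_wrap {r c : ℕ} (hr : r < k) (hc : c + 1 = 4 * n * k) (hc0 : 0 < c) :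
    (mixedGrid k n Ih Ic).Adj (vtx _ r c hr) (vtx _ r 0 hr) := by
  refine ⟨vtx_ne_of_col hr hr (by omega) (by omega) (by omega), Or.inl (Or.inl ⟨rfl, ?_⟩)⟩
  simp only [vtx]; rw [hc]; simp

lemma adj_down {r c : ℕ} (hr : r + 1 < k) :
    (mixedGrid k n Ih Ic).Adj (vtx _ r c (by omega)) (vtx _ (r + 1) c hr) := by
  refine ⟨?_, Or.inl (Or.inr (Or.inl ⟨rfl, rfl⟩))⟩
  intro e
  have := congrArg (fun v => (v.1 : ℕ)) e
  simp [vtx] at this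

lemma block_le {k n i : ℕ} (hi : i < n) : 4 * k * i + 4 * k ≤ 4 * n * k := by
  have : 4 * k * (i + 1) ≤ 4 * k * n := Nat.mul_le_mul_left _ hi
  calc 4 * k * i + 4 * k = 4 * k * (i + 1) := by ring
    _ ≤ 4 * k * n := this
    _ = 4 * n * k := by ring

lemma adj_hdl1 {i a : ℕ} (hi : i + 1 ∈ Ih) (hin : i < n) (ha : a < k) :
    (mixedGrid k n Ih Ic).Adj (vtx _ 0 (4 * k * i + a) (by omega))
      (vtx _ 0 (4 * k * i + 3 * k - 1 - a) (by omega)) := by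
  have := block_le (k := k) hin
  refine ⟨vtx_ne_of_col _ _ (by omega) (by omega) (by omega), Or.inl (Or.inr (Or.inr (Or.inl
    ⟨rfl, rfl, i + 1, hi, a + 1, by simp; omega, Or.inl ⟨?_, ?_⟩⟩)))⟩
  · simp only [vtx, Nat.add_sub_cancel]; congr 1
  · simp only [vtx, Nat.add_sub_cancel]; congr 1; omega

lemma adj_hdl2 {i a : ℕ} (hi : i + 1 ∈ Ih) (hin : i < n) (ha : a < k) :
    (mixedGrid k n Ih Ic).Adj (vtx _ 0 (4 * k * i + k + a) (by omega))
      (vtx _ 0 (4 * k * i + 4 * k - 1 - a) (by omega)) := by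
  have := block_le (k := k) hin
  refine ⟨vtx_ne_of_col _ _ (by omega) (by omega) (by omega), Or.inl (Or.inr (Or.inr (Or.inl
    ⟨rfl, rfl, i + 1, hi, a + 1, by simp; omega, Or.inr ⟨?_, ?_⟩⟩)))⟩
  · simp only [vtx, Nat.add_sub_cancel]; congr 1
  · simp only [vtx, Nat.add_sub_cancel]; congr 1; omega

lemma adj_crs {i a : ℕ} (hi : i + 1 ∈ Ic) (hin : i < n) (ha : a < 2 * k) :
    (mixedGrid k n Ih Ic).Adj (vtx _ 0 (4 * k * i + a) (by omega))
      (vtx _ 0 (4 * k * i + 2 * k + a) (by omega)) := by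
  have := block_le (k := k) hin
  refine ⟨vtx_ne_of_col _ _ (by omega) (by omega) (by omega), Or.inl (Or.inr (Or.inr (Or.inr
    ⟨rfl, rfl, i + 1, hi, a + 1, by simp; omega, ?_, ?_⟩)))⟩
  · simp only [vtx, Nat.add_sub_cancel]; congr 1
  · simp only [vtx, Nat.add_sub_cancel]; congr 1

/-- Axis-parallel segments / rectangles. -/
def Seg (k N r0 r1 c0 c1 : ℕ) : Set (Fin k × ZMod N) :=
  {v | r0 ≤ (v.1 : ℕ) ∧ (v.1 : ℕ) ≤ r1 ∧ c0 ≤ colOf v ∧ colOf v ≤ c1}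

lemma mem_Seg_vtx {k N r0 r1 c0 c1 r c : ℕ} (hr : r < k) (hc : c < N) (h1 : r0 ≤ r) (h2 : r ≤ r1)
    (h3 : c0 ≤ c) (h4 : c ≤ c1) : vtx N r c hr ∈ Seg k N r0 r1 c0 c1 := by
  simp only [Seg, Set.mem_ofPred_eq, vtx_fst, colOf_vtx hr hc]
  exact ⟨h1, h2, h3, h4⟩

lemma path_connected {V : Type*} (G : SimpleGraph V) (w : ℕ → V) (L : ℕ)
    (h : ∀ d < L, G.Adj (w d) (w (d + 1))) : (G.induce {v | ∃ d ≤ L, v = w d}).Connected := by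
  induction L with
  | zero =>
    have : {v | ∃ d ≤ 0, v = w d} = {w 0} := by
      ext v; simp
    rw [this]
    have : Unique ↑({w 0} : Set V) := Set.uniqueSingleton _
    exact ⟨Preconnected.of_subsingleton⟩
  | succ L ih =>
    have e : {v | ∃ d ≤ L + 1, v = w d} = {v | ∃ d ≤ L, v = w d} ∪ {w L, w (L + 1)} := by
      ext v
      simp only [Set.mem_ofPred_eq, Set.mem_union, Set.mem_insert_iff, Set.mem_singleton_iff]
      constructor
      · rintro ⟨d, hd, rfl⟩
        rcases Nat.lt_or_ge L d with h1 | h1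
        · have : d = L + 1 := by omega
          subst this; simp
        · exact Or.inl ⟨d, h1, rfl⟩
      · rintro (⟨d, hd, rfl⟩ | rfl | rfl)
        · exact ⟨d, by omega, rfl⟩
        · exact ⟨L, by omega, rfl⟩
        · exact ⟨L + 1, by omega, rfl⟩
    rw [e]
    exact induce_union_connected (ih (fun d hd => h d (by omega))).preconnected
      (induce_pair_connected_of_adj (h L (by omega))).preconnected
      ⟨w L, ⟨L, le_rfl, rfl⟩, by simp⟩

lemma hseg_connected {r c0 c1 : ℕ} (hr : r < k) (h : c0 ≤ c1) (hc : c1 < 4 * n * k) :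
    ((mixedGrid k n Ih Ic).induce (Seg k (4 * n * k) r r c0 c1)).Connected := by
  have e : Seg k (4 * n * k) r r c0 c1 =
      {v | ∃ d ≤ c1 - c0, v = vtx (4 * n * k) r (c0 + d) hr} := by
    ext v
    constructor
    · rintro ⟨h1, h2, h3, h4⟩
      refine ⟨colOf v - c0, by omega, ?_⟩
      have e1 : c0 + (colOf v - c0) = colOf v := by omega
      have e2 : r = v.1 := by omega
      subst e2
      rw [e1]
      exact eq_vtx (by omega) v
    · rintro ⟨d, hd, rfl⟩
      exact mem_Seg_vtx _ (by omega) le_rfl le_rfl (by omega) (by omega)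
  rw [e]
  exact path_connected _ (fun d => vtx (4 * n * k) r (c0 + d) hr) _
    (fun d hd => adj_right hr (by omega))

lemma vseg_connected {r c : ℕ} (hr : r < k) (hc : c < 4 * n * k) :
    ((mixedGrid k n Ih Ic).induce (Seg k (4 * n * k) 0 r c c)).Connected := by
  have e : Seg k (4 * n * k) 0 r c c =
      {v | ∃ d ≤ r, v = vtx (4 * n * k) (min d r) c (by omega)} := by
    ext v
    constructor
    · rintro ⟨h1, h2, h3, h4⟩
      refine ⟨v.1, by omega, ?_⟩
      have e1 : c = colOf v := by omega
      have e2 : min (v.1 : ℕ) r = v.1 := by omega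
      subst e1
      simp only [e2]
      exact eq_vtx (by omega) v
    · rintro ⟨d, hd, rfl⟩
      exact mem_Seg_vtx _ (by omega) (by omega) (by omega) le_rfl le_rfl
  rw [e]
  refine path_connected _ (fun d => vtx (4 * n * k) (min d r) c (by omega)) _ (fun d hd => ?_)
  have e1 : min d r = d := by omega
  have e2 : min (d + 1) r = d + 1 := by omega
  simp only [e1, e2]
  exact adj_down (by omega)

end adj


def phiH (k q : ℕ) : ℕ :=
  if q < k then q else if q < 2 * k then q + 8 * k else if q < 3 * k then q + 24 * k
  else q + 32 * k

def phiC (k q : ℕ) : ℕ := if q < 2 * k then q else q + 16 * k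

def offs (k j0 : ℕ) (Ih : Finset ℕ) (p q : ℕ) : ℕ :=
  if p = j0 then 40 * k + phiC k q
  else if p = j0 + 1 then 24 * k + q
  else if p + 1 ∈ Ih then phiH k q else phiC k q

/-- Source column of the target column `u`. -/
def fcol (k j0 : ℕ) (Ih : Finset ℕ) (u : ℕ) : ℕ :=
  36 * (k * (u / (4 * k))) + offs k j0 Ih (u / (4 * k)) (u % (4 * k))

lemma fcol_eq {k j0 : ℕ} {Ih : Finset ℕ} {p q : ℕ} (hq : q < 4 * k) :
    fcol k j0 Ih (4 * k * p + q) = 36 * (k * p) + offs k j0 Ih p q := by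
  have h1 : (4 * k * p + q) / (4 * k) = p := by
    rw [Nat.mul_add_div (by omega), Nat.div_eq_of_lt hq]; rfl
  have h2 : (4 * k * p + q) % (4 * k) = q := by
    rw [Nat.mul_add_mod, Nat.mod_eq_of_lt hq]
  rw [fcol, h1, h2]

lemma offs_bound {k j0 : ℕ} {Ih : Finset ℕ} {p q : ℕ} (hq : q < 4 * k) :
    (p ≠ j0 → offs k j0 Ih p q < 36 * k) ∧ (p = j0 → 40 * k ≤ offs k j0 Ih p q ∧
      offs k j0 Ih p q < 60 * k ∧ (offs k j0 Ih p q < 42 * k ∨ 58 * k ≤ offs k j0 Ih p q))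
    ∧ (p = j0 + 1 → 24 * k ≤ offs k j0 Ih p q) := by
  unfold offs phiC phiH
  refine ⟨?_, ?_, ?_⟩ <;> intro h <;> split_ifs <;> omega

lemma offs_mono {k j0 : ℕ} {Ih : Finset ℕ} {p q q' : ℕ} (hqq : q < q') (hq : q' < 4 * k) :
    offs k j0 Ih p q < offs k j0 Ih p q' := by
  unfold offs phiC phiH
  split_ifs <;> omega

lemma exists_split {k : ℕ} (hk : 1 ≤ k) (u : ℕ) : ∃ p q, q < 4 * k ∧ u = 4 * k * p + q :=
  ⟨u / (4 * k), u % (4 * k), Nat.mod_lt _ (by omega), (Nat.div_add_mod u (4 * k)).symm⟩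

lemma fcol_mono {k j0 : ℕ} {Ih : Finset ℕ} (hk : 1 ≤ k) : StrictMono (fcol k j0 Ih) := by
  intro u u' huu
  obtain ⟨p, q, hq, rfl⟩ := exists_split hk u
  obtain ⟨p', q', hq', rfl⟩ := exists_split hk u'
  rw [fcol_eq hq, fcol_eq hq']
  rcases lt_trichotomy p p' with h | h | h
  · have hm : k * (p + 1) ≤ k * p' := Nat.mul_le_mul_left _ h
    rw [Nat.mul_add] at hm
    have b := offs_bound (j0 := j0) (Ih := Ih) (p := p) hq
    have b' := offs_bound (j0 := j0) (Ih := Ih) (p := p') hq'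
    by_cases e : p = j0
    · by_cases e' : p' = j0 + 1
      · have := b.2.1 e
        have := b'.2.2 e'
        omega
      · have hm : k * (p + 2) ≤ k * p' := Nat.mul_le_mul_left _ (by omega)
        rw [Nat.mul_add] at hm
        have := b.2.1 e
        omega
    · have := b.1 e
      omega
  · subst h
    have := offs_mono (j0 := j0) (Ih := Ih) (p := p) (q := q) (q' := q') (by omega) hq'
    omega
  · have hm : 4 * k * p' + 4 * k ≤ 4 * k * p := by
      have : 4 * k * (p' + 1) ≤ 4 * k * p := Nat.mul_le_mul_left _ h
      rwa [Nat.mul_add, Nat.mul_one] at this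
    omega

/-- The straight columns avoid the rerouting regions. -/
lemma fcol_avoid {k j0 : ℕ} {Ih : Finset ℕ} (hk : 1 ≤ k) (u : ℕ) :
    fcol k j0 Ih u < 36 * (k * j0) ∨
    (36 * (k * j0) + 40 * k ≤ fcol k j0 Ih u ∧ fcol k j0 Ih u < 36 * (k * j0) + 42 * k) ∨
    36 * (k * j0) + 58 * k ≤ fcol k j0 Ih u := by
  obtain ⟨p, q, hq, rfl⟩ := exists_split hk u
  rw [fcol_eq hq]
  have b := offs_bound (j0 := j0) (Ih := Ih) (p := p) hq
  rcases lt_trichotomy p j0 with h | h | h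
  · have hm : k * (p + 1) ≤ k * j0 := Nat.mul_le_mul_left _ h
    rw [Nat.mul_add] at hm
    have := b.1 (by omega)
    omega
  · have := b.2.1 h
    subst h
    omega
  · by_cases e : p = j0 + 1
    · have := b.2.2 e
      subst e
      rw [Nat.mul_add]
      omega
    · have hm : k * (j0 + 2) ≤ k * p := Nat.mul_le_mul_left _ (by omega)
      rw [Nat.mul_add] at hm
      omega

lemma phiH_mono {k q q' : ℕ} (h : q < q') (hq : q' < 4 * k) : phiH k q < phiH k q' := by
  unfold phiH
  split_ifs <;> omega

lemma phiH_bound {k q : ℕ} (hq : q < 4 * k) : phiH k q < 36 * k := by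
  unfold phiH
  split_ifs <;> omega

/-- The rerouted extra path for the handle track `s < 4k`; `b = 36 k j0` is the source column of the
left end of the block of the source handle. -/
def Extra (k N b s : ℕ) : Set (Fin (9 * k) × ZMod N) :=
  ((Seg (9 * k) N 0 (4 * k - s) (b + 42 * k + s) (b + 42 * k + s) ∪
    Seg (9 * k) N (4 * k - s) (4 * k - s) (b + 42 * k + s) (b + 58 * k - 1 - s)) ∪
    Seg (9 * k) N 0 (4 * k - s) (b + 58 * k - 1 - s) (b + 58 * k - 1 - s)) ∪
  ((Seg (9 * k) N 0 (4 * k - s) (b + 40 * k - 1 - s) (b + 40 * k - 1 - s) ∪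
    Seg (9 * k) N (4 * k - s) (4 * k - s) (b + phiH k s) (b + 40 * k - 1 - s)) ∪
    Seg (9 * k) N 0 (4 * k - s) (b + phiH k s) (b + phiH k s))

lemma extra_disjoint {k N b s s' : ℕ} (hs : s < s') (hs' : s' < 4 * k) :
    Disjoint (Extra k N b s) (Extra k N b s') := by
  have h1 := phiH_mono hs hs'
  have h2 := phiH_bound hs'
  rw [Set.disjoint_left]
  intro v hv hv'
  simp only [Extra, Seg, Set.mem_union, Set.mem_ofPred_eq] at hv hv'
  generalize colOf v = x at *
  generalize (v.1 : ℕ) = y at *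
  rcases hv with ((hv | hv) | hv) | ((hv | hv) | hv) <;> omega

/-- Branch sets without the rerouting. -/
def Base (k N : ℕ) (f : ℕ → ℕ) (i u : ℕ) : Set (Fin (9 * k) × ZMod N) :=
  if i = 0 then Seg (9 * k) N (8 * k) (8 * k) (f u) (f (u + 1) - 1) ∪ Seg (9 * k) N 0 (8 * k) (f u) (f u)
  else Seg (9 * k) N (8 * k + i) (8 * k + i) (f u) (f (u + 1) - 1)

lemma mem_Base {k N i u : ℕ} {f : ℕ → ℕ} (hf : f u < f (u + 1)) {v} (hv : v ∈ Base k N f i u) :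
    f u ≤ colOf v ∧ colOf v < f (u + 1) ∧
    ((v.1 : ℕ) = 8 * k + i ∨ (i = 0 ∧ (v.1 : ℕ) ≤ 8 * k ∧ colOf v = f u)) := by
  unfold Base at hv
  split_ifs at hv with h
  · simp only [Seg, Set.mem_union, Set.mem_ofPred_eq] at hv
    omega
  · simp only [Seg, Set.mem_ofPred_eq] at hv
    omega

lemma base_disjoint {k N i u i' u' : ℕ} {f : ℕ → ℕ} (hf : StrictMono f)
    (h : ¬ (i = i' ∧ u = u')) : Disjoint (Base k N f i u) (Base k N f i' u') := by
  rw [Set.disjoint_left]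
  intro v hv hv'
  have h1 := mem_Base (hf (Nat.lt_add_one u)) hv
  have h2 := mem_Base (hf (Nat.lt_add_one u')) hv'
  rcases lt_trichotomy u u' with e | e | e
  · have := hf.monotone (show u + 1 ≤ u' from e)
    omega
  · subst e
    omega
  · have := hf.monotone (show u' + 1 ≤ u from e)
    omega

lemma base_extra_disjoint {k N i u b s : ℕ} {f : ℕ → ℕ} (hk : 1 ≤ k) (hf : f u < f (u + 1))
    (hav : f u < b ∨ (b + 40 * k ≤ f u ∧ f u < b + 42 * k) ∨ b + 58 * k ≤ f u) (hs : s < 4 * k) :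
    Disjoint (Base k N f i u) (Extra k N b s) := by
  have h2 := phiH_bound hs
  rw [Set.disjoint_left]
  intro v hv hv'
  have h1 := mem_Base hf hv
  simp only [Extra, Seg, Set.mem_union, Set.mem_ofPred_eq] at hv'
  rcases hv' with ((hv | hv) | hv) | ((hv | hv) | hv) <;> omega


section main
variable {k n j0 : ℕ} {Ih Ic : Finset ℕ}

lemma big_hdl1 {i a x y : ℕ} (hk : 1 ≤ k) (hi : i + 1 ∈ Ih) (hin : i < n) (ha : a < 9 * k)
    (hx : x = 36 * (k * i) + a) (hy : y = 36 * (k * i) + 27 * k - 1 - a) :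
    (mixedGrid (9 * k) n Ih Ic).Adj (vtx _ 0 x (by omega)) (vtx _ 0 y (by omega)) := by
  have e : 4 * (9 * k) * i = 36 * (k * i) := by ring
  have h := adj_hdl1 (k := 9 * k) (Ic := Ic) hi hin ha
  have ex : x = 4 * (9 * k) * i + a := by omega
  have ey : y = 4 * (9 * k) * i + 3 * (9 * k) - 1 - a := by omega
  rw [← ex, ← ey] at h
  exact h

lemma big_hdl2 {i a x y : ℕ} (hk : 1 ≤ k) (hi : i + 1 ∈ Ih) (hin : i < n) (ha : a < 9 * k)
    (hx : x = 36 * (k * i) + 9 * k + a) (hy : y = 36 * (k * i) + 36 * k - 1 - a) :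
    (mixedGrid (9 * k) n Ih Ic).Adj (vtx _ 0 x (by omega)) (vtx _ 0 y (by omega)) := by
  have e : 4 * (9 * k) * i = 36 * (k * i) := by ring
  have h := adj_hdl2 (k := 9 * k) (Ic := Ic) hi hin ha
  have ex : x = 4 * (9 * k) * i + 9 * k + a := by omega
  have ey : y = 4 * (9 * k) * i + 4 * (9 * k) - 1 - a := by omega
  rw [← ex, ← ey] at h
  exact h

lemma big_crs {i a x y : ℕ} (hk : 1 ≤ k) (hi : i + 1 ∈ Ic) (hin : i < n) (ha : a < 18 * k)
    (hx : x = 36 * (k * i) + a) (hy : y = 36 * (k * i) + 18 * k + a) :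
    (mixedGrid (9 * k) n Ih Ic).Adj (vtx _ 0 x (by omega)) (vtx _ 0 y (by omega)) := by
  have e : 4 * (9 * k) * i = 36 * (k * i) := by ring
  have h := adj_crs (k := 9 * k) (Ih := Ih) (a := a) hi hin (by omega)
  have ex : x = 4 * (9 * k) * i + a := by omega
  have ey : y = 4 * (9 * k) * i + 2 * (9 * k) + a := by omega
  rw [← ex, ← ey] at h
  exact h

lemma base_connected {f : ℕ → ℕ} {i u : ℕ} (hi : i < k) (hf : f u < f (u + 1))
    (hN : f (u + 1) ≤ 4 * n * (9 * k)) :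
    ((mixedGrid (9 * k) n Ih Ic).induce (Base k (4 * n * (9 * k)) f i u)).Connected := by
  unfold Base
  by_cases h : i = 0
  · rw [if_pos h]
    have h1 := hseg_connected (k := 9 * k) (n := n) (Ih := Ih) (Ic := Ic) (r := 8 * k) (c0 := f u)
      (c1 := f (u + 1) - 1) (by omega) (by omega) (by omega)
    have h2 := vseg_connected (k := 9 * k) (n := n) (Ih := Ih) (Ic := Ic) (r := 8 * k) (c := f u)
      (by omega) (by omega)
    exact induce_union_connected h1.preconnected h2.preconnected
      ⟨vtx _ (8 * k) (f u) (by omega), mem_Seg_vtx _ (by omega) le_rfl le_rfl le_rfl (by omega),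
        mem_Seg_vtx _ (by omega) (by omega) le_rfl le_rfl le_rfl⟩
  · rw [if_neg h]
    exact hseg_connected (k := 9 * k) (n := n) (by omega) (by omega) (by omega)

lemma union_swap3 {α : Type*} (a b c : Set α) : (a ∪ b) ∪ c = (c ∪ b) ∪ a := by
  ext x
  simp only [Set.mem_union]
  tauto

lemma ushape_connected {r c d : ℕ} (hr : r < k) (hcd : c ≤ d) (hd : d < 4 * n * k) :
    ((mixedGrid k n Ih Ic).induce ((Seg k (4 * n * k) 0 r c c ∪ Seg k (4 * n * k) r r c d) ∪
      Seg k (4 * n * k) 0 r d d)).Connected := by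
  refine induce_union_connected (Connected.preconnected ?_) (vseg_connected hr hd).preconnected
    ⟨vtx _ r d hr, Or.inr (mem_Seg_vtx hr hd le_rfl le_rfl hcd le_rfl),
      mem_Seg_vtx hr hd (by omega) le_rfl le_rfl le_rfl⟩
  exact induce_union_connected (vseg_connected hr (by omega)).preconnected
    (hseg_connected hr hcd hd).preconnected
    ⟨vtx _ r c hr, mem_Seg_vtx hr (by omega) (by omega) le_rfl le_rfl le_rfl,
      mem_Seg_vtx hr (by omega) le_rfl le_rfl le_rfl hcd⟩

lemma extra_connected {s : ℕ} (hk : 1 ≤ k) (hs : s < 4 * k) (hj : j0 + 1 < n)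
    (hjc : j0 + 2 ∈ Ic) :
    ((mixedGrid (9 * k) n Ih Ic).induce
      (Extra k (4 * n * (9 * k)) (36 * (k * j0)) s)).Connected := by
  have hN : 4 * n * (9 * k) = 36 * (k * n) := by ring
  have hm : k * (j0 + 2) ≤ k * n := Nat.mul_le_mul_left _ (by omega)
  rw [Nat.mul_add] at hm
  have hm1 : k * (j0 + 1) = k * j0 + k := by ring
  have hp := phiH_bound hs
  unfold Extra
  refine connected_induce_union (v := vtx _ 0 (36 * (k * j0) + 58 * k - 1 - s) (by omega))
    (w := vtx _ 0 (36 * (k * j0) + 40 * k - 1 - s) (by omega))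
    (ushape_connected (by omega) (by omega) (by omega)).preconnected
    (Connected.preconnected ?_)
    (Or.inr (mem_Seg_vtx _ (by omega) (by omega) (by omega) le_rfl le_rfl))
    (Or.inl (Or.inl (mem_Seg_vtx _ (by omega) (by omega) (by omega) le_rfl le_rfl))) ?_
  · have := ushape_connected (k := 9 * k) (n := n) (Ih := Ih) (Ic := Ic) (r := 4 * k - s)
      (c := 36 * (k * j0) + phiH k s) (d := 36 * (k * j0) + 40 * k - 1 - s)
      (by omega) (by omega) (by omega)
    rw [union_swap3]
    exact this
  · exact (big_crs (i := j0 + 1) (a := 4 * k - 1 - s) hk hjc hj (by omega) (by omega)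
      (by omega)).symm

/-- The branch sets. -/
def Branch (k n j0 : ℕ) (Ih : Finset ℕ) (v : Fin k × ZMod (4 * n * k)) :
    Set (Fin (9 * k) × ZMod (4 * n * (9 * k))) :=
  Base k (4 * n * (9 * k)) (fcol k j0 Ih) v.1 (colOf v) ∪
    if (v.1 : ℕ) = 0 ∧ 4 * (k * j0) + 4 * k ≤ colOf v ∧ colOf v < 4 * (k * j0) + 8 * k then
      Extra k (4 * n * (9 * k)) (36 * (k * j0)) (colOf v - (4 * (k * j0) + 4 * k)) else ∅

lemma fcol_top (hk : 1 ≤ k) (hj : j0 + 1 < n) : fcol k j0 Ih (4 * n * k) = 4 * n * (9 * k) := by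
  have h := fcol_eq (k := k) (j0 := j0) (Ih := Ih) (p := n) (q := 0) (by omega)
  have e : 4 * k * n + 0 = 4 * n * k := by ring
  have e' : 4 * n * (9 * k) = 36 * (k * n) := by ring
  rw [e] at h
  rw [h, e']
  unfold offs phiC phiH
  split_ifs <;> omega

lemma fcol_zero (hk : 1 ≤ k) (hj : 1 ≤ j0) : fcol k j0 Ih 0 = 0 := by
  unfold fcol
  rw [Nat.zero_div, Nat.zero_mod, Nat.mul_zero]
  have h1 : phiH k 0 = 0 := if_pos (by omega)
  have h2 : phiC k 0 = 0 := if_pos (by omega)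
  rw [offs, if_neg (by omega), if_neg (by omega), h1, h2, ite_self]

lemma fcol_j1 {s : ℕ} (hs : s < 4 * k) :
    fcol k j0 Ih (4 * (k * j0) + 4 * k + s) = 36 * (k * j0) + 60 * k + s := by
  have h := fcol_eq (k := k) (j0 := j0) (Ih := Ih) (p := j0 + 1) (q := s) hs
  have e : 4 * k * (j0 + 1) = 4 * (k * j0) + 4 * k := by ring
  rw [e] at h
  rw [h]
  have e : k * (j0 + 1) = k * j0 + k := by ring
  unfold offs
  simp
  omega

lemma fcol_le (hk : 1 ≤ k) (hj : j0 + 1 < n) {u : ℕ} (hu : u < 4 * n * k) :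
    fcol k j0 Ih (u + 1) ≤ 4 * n * (9 * k) := by
  rw [← fcol_top (Ih := Ih) hk hj]
  exact (fcol_mono hk).monotone hu

lemma pos_N (hk : 1 ≤ k) (hj : j0 + 1 < n) : 0 < 4 * n * k := by
  have : 0 < n := by omega
  positivity

lemma branch_connected (hk : 1 ≤ k) (hj : j0 + 1 < n) (hjc : j0 + 2 ∈ Ic)
    (v : Fin k × ZMod (4 * n * k)) :
    ((mixedGrid (9 * k) n Ih Ic).induce (Branch k n j0 Ih v)).Connected := by
  have hcol := colOf_lt (pos_N hk hj) v
  have hle := fcol_le (Ih := Ih) hk hj hcol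
  have hlt := fcol_mono (j0 := j0) (Ih := Ih) hk (Nat.lt_add_one (colOf v))
  have hb := base_connected (Ih := Ih) (Ic := Ic) (f := fcol k j0 Ih) v.1.2 hlt hle
  have hm : k * (j0 + 1) = k * j0 + k := by ring
  unfold Branch
  by_cases h : (v.1 : ℕ) = 0 ∧ 4 * (k * j0) + 4 * k ≤ colOf v ∧ colOf v < 4 * (k * j0) + 8 * k
  · rw [if_pos h]
    obtain ⟨h0, h1, h2⟩ := h
    obtain ⟨s, hs⟩ := Nat.exists_eq_add_of_le h1
    have hf := fcol_j1 (k := k) (j0 := j0) (Ih := Ih) (s := s) (by omega)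
    rw [← hs] at hf
    have e : colOf v - (4 * (k * j0) + 4 * k) = s := by omega
    rw [e]
    refine connected_induce_union (v := vtx _ 0 (36 * (k * j0) + 60 * k + s) (by omega))
      (w := vtx _ 0 (36 * (k * j0) + 42 * k + s) (by omega)) hb.preconnected
      (extra_connected hk (by omega) hj hjc).preconnected ?_ ?_ ?_
    · unfold Base
      rw [if_pos h0]
      exact Or.inr (mem_Seg_vtx _ (by omega) (by omega) (by omega) (by omega) (by omega))
    · exact Or.inl (Or.inl (Or.inl
        (mem_Seg_vtx _ (by omega) (by omega) (by omega) (by omega) (by omega))))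
    · exact (big_crs (i := j0 + 1) (a := 6 * k + s) hk hjc hj (by omega) (by omega)
        (by omega)).symm
  · rw [if_neg h, Set.union_empty]
    exact hb

lemma branch_disjoint (hk : 1 ≤ k) (hj : j0 + 1 < n)
    (v w : Fin k × ZMod (4 * n * k)) (hvw : v ≠ w) :
    Disjoint (Branch k n j0 Ih v) (Branch k n j0 Ih w) := by
  have hne : ¬ ((v.1 : ℕ) = w.1 ∧ colOf v = colOf w) := by
    rintro ⟨h1, h2⟩
    apply hvw
    have e1 := eq_vtx (pos_N hk hj) v
    have e2 := eq_vtx (pos_N hk hj) w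
    rw [e1, e2]
    simp only [h1, h2]
  have hmono := fcol_mono (j0 := j0) (Ih := Ih) hk
  have hbe : ∀ i u s, s < 4 * k → Disjoint (Base k (4 * n * (9 * k)) (fcol k j0 Ih) i u)
      (Extra k (4 * n * (9 * k)) (36 * (k * j0)) s) := fun i u s hs =>
    base_extra_disjoint hk (hmono (Nat.lt_add_one u)) (fcol_avoid hk u) hs
  unfold Branch
  rw [Set.disjoint_union_left, Set.disjoint_union_right, Set.disjoint_union_right]
  refine ⟨⟨base_disjoint hmono hne, ?_⟩, ?_, ?_⟩
  · split_ifs with h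
    · exact hbe _ _ _ (by omega)
    · simp
  · split_ifs with h
    · exact (hbe _ _ _ (by omega)).symm
    · simp
  · split_ifs with h h'
    · rcases lt_trichotomy (colOf v) (colOf w) with e | e | e
      · exact extra_disjoint (by omega) (by omega)
      · omega
      · exact (extra_disjoint (by omega) (by omega)).symm
    all_goals simp

lemma mem_branch_row (hk : 1 ≤ k) (hj : j0 + 1 < n) (v : Fin k × ZMod (4 * n * k)) {r c : ℕ}
    (hr : r < 9 * k) (hr' : r = 8 * k + v.1) (h1 : fcol k j0 Ih (colOf v) ≤ c)
    (h2 : c < fcol k j0 Ih (colOf v + 1)) : vtx _ r c hr ∈ Branch k n j0 Ih v := by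
  have hle := fcol_le (Ih := Ih) hk hj (colOf_lt (pos_N hk hj) v)
  left
  unfold Base
  split_ifs with h
  · exact Or.inl (mem_Seg_vtx _ (by omega) (by omega) (by omega) (by omega) (by omega))
  · exact mem_Seg_vtx _ (by omega) (by omega) (by omega) (by omega) (by omega)

lemma mem_branch_top (hk : 1 ≤ k) (hj : j0 + 1 < n) (v : Fin k × ZMod (4 * n * k)) {p q c : ℕ}
    (h0 : (v.1 : ℕ) = 0) (hq : q < 4 * k) (hv : colOf v = 4 * k * p + q)
    (hc : c = 36 * (k * p) + offs k j0 Ih p q) :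
    vtx _ 0 c (by omega) ∈ Branch k n j0 Ih v := by
  have hle := fcol_le (Ih := Ih) hk hj (colOf_lt (pos_N hk hj) v)
  have hlt := fcol_mono (j0 := j0) (Ih := Ih) hk (Nat.lt_add_one (colOf v))
  have hf := fcol_eq (k := k) (j0 := j0) (Ih := Ih) (p := p) hq
  rw [← hv] at hf
  left
  unfold Base
  rw [if_pos h0]
  exact Or.inr (mem_Seg_vtx _ (by omega) (by omega) (by omega) (by omega) (by omega))

lemma mem_branch_extra (hk : 1 ≤ k) (hj : j0 + 1 < n) (v : Fin k × ZMod (4 * n * k)) {q c : ℕ}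
    (h0 : (v.1 : ℕ) = 0) (hq : q < 4 * k) (hv : colOf v = 4 * k * (j0 + 1) + q)
    (hc : c = 36 * (k * j0) + phiH k q) :
    vtx _ 0 c (by omega) ∈ Branch k n j0 Ih v := by
  have hN : 4 * n * (9 * k) = 36 * (k * n) := by ring
  have hm : k * (j0 + 2) ≤ k * n := Nat.mul_le_mul_left _ (by omega)
  rw [Nat.mul_add] at hm
  have hp := phiH_bound hq
  have e : 4 * k * (j0 + 1) = 4 * (k * j0) + 4 * k := by ring
  right
  rw [if_pos ⟨h0, by omega, by omega⟩]
  have e : colOf v - (4 * (k * j0) + 4 * k) = q := by omega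
  rw [e]
  exact Or.inr (Or.inr (mem_Seg_vtx _ (by omega) (by omega) (by omega) (by omega) (by omega)))

/-- Top vertices of the branch sets of a handle block of the target. -/
lemma handle_top (hk : 1 ≤ k) (hj : j0 + 1 < n) (hj0 : j0 + 1 ∈ Ih)
    {i : ℕ} (hin : i < n) (hi : i + 1 ∈ insert (j0 + 2) (Ih.erase (j0 + 1))) :
    ∃ i', i' + 1 ∈ Ih ∧ i' < n ∧ ∀ (v : Fin k × ZMod (4 * n * k)) (q c : ℕ), (v.1 : ℕ) = 0 →
      q < 4 * k → colOf v = 4 * k * i + q → c = 36 * (k * i') + phiH k q →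
      ∀ h : 0 < 9 * k, vtx _ 0 c h ∈ Branch k n j0 Ih v := by
  by_cases e : i = j0 + 1
  · subst e
    exact ⟨j0, hj0, by omega, fun v q c h0 hq hv hc _ => mem_branch_extra hk hj v h0 hq hv hc⟩
  · have hi' : i + 1 ≠ j0 + 1 ∧ i + 1 ∈ Ih := by
      rcases Finset.mem_insert.1 hi with h | h
      · omega
      · exact Finset.mem_erase.1 h
    refine ⟨i, hi'.2, hin, fun v q c h0 hq hv hc _ => mem_branch_top hk hj v h0 hq hv ?_⟩
    rw [hc, offs, if_neg (by omega), if_neg e, if_pos hi'.2]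

/-- Top vertices of the branch sets of a crosscap block of the target. -/
lemma cross_top (hk : 1 ≤ k) (hj : j0 + 1 < n) (hdisj : Disjoint Ih Ic) (hj0 : j0 + 1 ∈ Ih)
    (hjc : j0 + 2 ∈ Ic)
    {i : ℕ} (hin : i < n) (hi : i + 1 ∈ insert (j0 + 1) (Ic.erase (j0 + 2))) :
    ∃ i' o, i' + 1 ∈ Ic ∧ i' < n ∧ o ≤ 4 * k ∧ ∀ (v : Fin k × ZMod (4 * n * k)) (q c : ℕ),
      (v.1 : ℕ) = 0 → q < 4 * k → colOf v = 4 * k * i + q → c = 36 * (k * i') + o + phiC k q →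
      ∀ h : 0 < 9 * k, vtx _ 0 c h ∈ Branch k n j0 Ih v := by
  by_cases e : i = j0
  · subst e
    refine ⟨i + 1, 4 * k, hjc, by omega, le_rfl, fun v q c h0 hq hv hc _ =>
      mem_branch_top hk hj v h0 hq hv ?_⟩
    rw [hc, offs, if_pos rfl]
    ring
  · have hi' : i + 1 ≠ j0 + 2 ∧ i + 1 ∈ Ic := by
      rcases Finset.mem_insert.1 hi with h | h
      · omega
      · exact Finset.mem_erase.1 h
    refine ⟨i, 0, hi'.2, hin, by omega, fun v q c h0 hq hv hc _ =>
      mem_branch_top hk hj v h0 hq hv ?_⟩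
    rw [hc, offs, if_neg e, if_neg (by omega),
      if_neg (fun h => Finset.disjoint_left.1 hdisj h hi'.2)]
    ring

end main

/-- Let `k, h, c ≥ 1` and let `{I'_hdl, I'_crscp}` be a partition of
`[2, h+c+1]` with `|I'_hdl| = h` and `|I'_crscp| = c`.  Suppose `j ∈ I'_hdl` and
`j+1 ∈ I'_crscp`, and set `J_hdl := (I'_hdl \ {j}) ∪ {j+1}` and
`J_crscp := (I'_crscp \ {j+1}) ∪ {j}`.  Then the mixed surface grid of order `9k` with
handle/crosscap positions `I'_hdl, I'_crscp` contains the mixed surface grid of order `k`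
with handle/crosscap positions `J_hdl, J_crscp` as a minor. -/
theorem mixedGrid_swap_handle_crosscap (k h c : ℕ) (hk : 1 ≤ k) (hh : 1 ≤ h) (hc : 1 ≤ c)
    (I'h I'c : Finset ℕ)
    (hpart : I'h ∪ I'c = Finset.Icc 2 (h + c + 1)) (hdisj : Disjoint I'h I'c)
    (hIh : I'h.card = h) (hIc : I'c.card = c)
    (j : ℕ) (hj : j ∈ I'h) (hj1 : j + 1 ∈ I'c) :
    IsMinorOf
      (mixedGrid k (h + c + 1) (insert (j + 1) (I'h.erase j)) (insert j (I'c.erase (j + 1))))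
      (mixedGrid (9 * k) (h + c + 1) I'h I'c) := by
  obtain ⟨n, hn⟩ : ∃ n, n = h + c + 1 := ⟨_, rfl⟩
  rw [← hn] at hpart ⊢
  have hmem : ∀ i, i ∈ I'h ∪ I'c → 2 ≤ i ∧ i ≤ n := by
    intro i hi
    rw [hpart] at hi
    exact Finset.mem_Icc.1 hi
  have hjb := hmem j (Finset.mem_union_left _ hj)
  have hj1b := hmem (j + 1) (Finset.mem_union_right _ hj1)
  obtain ⟨j0, rfl⟩ : ∃ j0, j = j0 + 1 := ⟨j - 1, by omega⟩
  have hjn : j0 + 1 < n := by omega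
  have hJh : ∀ i ∈ insert (j0 + 1 + 1) (I'h.erase (j0 + 1)), 2 ≤ i ∧ i ≤ n := by
    intro i hi
    rcases Finset.mem_insert.1 hi with rfl | hi
    · omega
    · exact hmem i (Finset.mem_union_left _ (Finset.mem_of_mem_erase hi))
  have hJc : ∀ i ∈ insert (j0 + 1) (I'c.erase (j0 + 1 + 1)), 2 ≤ i ∧ i ≤ n := by
    intro i hi
    rcases Finset.mem_insert.1 hi with rfl | hi
    · omega
    · exact hmem i (Finset.mem_union_right _ (Finset.mem_of_mem_erase hi))
  have hM := pos_N hk hjn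
  have hN : 4 * n * (9 * k) = 9 * (4 * n * k) := by ring
  have hmono := fcol_mono (j0 := j0) (Ih := I'h) hk
  refine ⟨Branch k n j0 I'h, fun u v => branch_disjoint hk hjn u v,
    branch_connected hk hjn hj1, ?_⟩
  intro p q hpq
  obtain ⟨hne, hpq⟩ := hpq
  clear hne
  wlog hr : _ generalizing p q
  · obtain ⟨a, ha, b, hb, hab⟩ := this q p (Or.symm hpq) (hpq.resolve_left hr)
    exact ⟨b, hb, a, ha, hab.symm⟩
  clear hpq
  have hpl := fcol_le (Ih := I'h) hk hjn (colOf_lt hM p)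
  have hql := fcol_le (Ih := I'h) hk hjn (colOf_lt hM q)
  have hplt := hmono (Nat.lt_add_one (colOf p))
  have hqlt := hmono (Nat.lt_add_one (colOf q))
  have hp1 := p.1.2
  have hq1 := q.1.2
  rcases hr with ⟨h1, h2⟩ | ⟨h1, h2⟩ | ⟨h1, h2, i, hi, a, ha, h3⟩ | ⟨h1, h2, i, hi, a, ha, h3⟩
  · have h1' : (p.1 : ℕ) = q.1 := by rw [h1]
    rcases colOf_succ hM p q h2 with ⟨h3, h4⟩ | ⟨h3, h4⟩
    · rw [h4] at hqlt hql
      refine ⟨vtx _ (8 * k + p.1) (fcol k j0 I'h (colOf p + 1) - 1) (by omega),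
        mem_branch_row hk hjn p _ rfl (by omega) (by omega),
        vtx _ (8 * k + p.1) (fcol k j0 I'h (colOf p + 1) - 1 + 1) (by omega),
        mem_branch_row hk hjn q _ (by omega) (by rw [h4]; omega) (by rw [h4]; omega),
        adj_right _ (by omega)⟩
    · have ht := fcol_top (Ih := I'h) hk hjn
      have hz := fcol_zero (Ih := I'h) (k := k) (j0 := j0) hk (by omega)
      rw [← h3] at ht
      rw [h4] at hqlt
      refine ⟨vtx _ (8 * k + p.1) (4 * n * (9 * k) - 1) (by omega),
        mem_branch_row hk hjn p _ rfl (by omega) (by omega),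
        vtx _ (8 * k + p.1) 0 (by omega),
        mem_branch_row hk hjn q _ (by omega) (by rw [h4]; omega) (by rw [h4]; omega),
        adj_wrap _ (by omega) (by omega)⟩
  · have e : colOf p = colOf q := by simp only [colOf, h1]
    refine ⟨vtx _ (8 * k + p.1) (fcol k j0 I'h (colOf p)) (by omega),
      mem_branch_row hk hjn p _ rfl le_rfl hplt,
      vtx _ (8 * k + p.1 + 1) (fcol k j0 I'h (colOf p)) (by omega),
      mem_branch_row hk hjn q _ (by omega) (by rw [e]) (by rw [e]; exact hqlt),
      adj_down _⟩
  · have hib := hJh i hi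
    obtain ⟨i, rfl⟩ : ∃ a, i = a + 1 := ⟨i - 1, by omega⟩
    rw [Nat.add_sub_cancel] at h3
    have hbl := block_le (k := k) (n := n) (i := i) (by omega)
    obtain ⟨i', hi', hin', H⟩ := handle_top (k := k) (n := n) hk hjn hj (i := i) (by omega) hi
    rw [Finset.mem_Icc] at ha
    have h9 : 0 < 9 * k := by omega
    rcases h3 with ⟨h3, h4⟩ | ⟨h3, h4⟩
    · have c1 := colOf_of_eq p h3 (by omega) (by omega)
      have c2 := colOf_of_eq q h4 (by omega) (by omega)
      refine ⟨_, H p (a - 1) _ h1 (by omega) (by omega) rfl h9,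
        _, H q (3 * k - a) _ h2 (by omega) (by omega) rfl h9,
        big_hdl1 (a := a - 1) hk hi' hin' (by omega) ?_ ?_⟩
      · unfold phiH; split_ifs <;> omega
      · unfold phiH; split_ifs <;> omega
    · have c1 := colOf_of_eq p h3 (by omega) (by omega)
      have c2 := colOf_of_eq q h4 (by omega) (by omega)
      refine ⟨_, H p (k + a - 1) _ h1 (by omega) (by omega) rfl h9,
        _, H q (4 * k - a) _ h2 (by omega) (by omega) rfl h9,
        big_hdl2 (a := a - 1) hk hi' hin' (by omega) ?_ ?_⟩
      · unfold phiH; split_ifs <;> omega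
      · unfold phiH; split_ifs <;> omega
  · have hib := hJc i hi
    obtain ⟨i, rfl⟩ : ∃ a, i = a + 1 := ⟨i - 1, by omega⟩
    rw [Nat.add_sub_cancel] at h3
    have hbl := block_le (k := k) (n := n) (i := i) (by omega)
    obtain ⟨i', o, hi', hin', ho, H⟩ :=
      cross_top (k := k) (n := n) hk hjn hdisj hj hj1 (i := i) (by omega) hi
    rw [Finset.mem_Icc] at ha
    have h9 : 0 < 9 * k := by omega
    obtain ⟨h3, h4⟩ := h3
    have c1 := colOf_of_eq p h3 (by omega) (by omega)
    have c2 := colOf_of_eq q h4 (by omega) (by omega)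
    refine ⟨_, H p (a - 1) _ h1 (by omega) (by omega) rfl h9,
      _, H q (2 * k + a - 1) _ h2 (by omega) (by omega) rfl h9,
      big_crs (a := o + (a - 1)) hk hi' hin' (by omega) ?_ ?_⟩
    · unfold phiC; split_ifs <;> omega
    · unfold phiC; split_ifs <;> omega
end
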